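/- arXiv:1809.08639 — 5 statements merged into one kernel-verified Lean document; each statement's English description precedes it below -/
import Mathlib

section
/- Let n ≥ 5 and let P be a set of n points in the real plane in general position (no three points of P collinear). Let B be a finite set of points in the plane with B ∩ P = ∅ such that for every pair of distinct points p, q ∈ P there is a point b ∈ B lying on the line through p and q. Then |B| ≥ n. -/
/-- A finite set of points in the plane is in general position if no three of
its points are collinear. -/
def GenPos (P : Finset (ℝ × ℝ)) : Prop :=
  ∀ p ∈ P, ∀ q ∈ P, ∀ r ∈ P, p ≠ q → p ≠ r → q ≠ r →
    ¬ Collinear ℝ ({p, q, r} : Set (ℝ × ℝ))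

/-- `B` blocks `P` if every line through two distinct points of `P` contains a
point of `B`. -/
def Blocks (B P : Finset (ℝ × ℝ)) : Prop :=
  ∀ p ∈ P, ∀ q ∈ P, p ≠ q → ∃ b ∈ B, b ∈ affineSpan ℝ ({p, q} : Set (ℝ × ℝ))

open Module Finset Polynomial in
/-- A one-parameter family of weighted power sums of degree `d` that vanishes for more than `d`
parameters vanishes for all of them. -/
theorem sum_pow_pencil_eq_zero {ι : Type*} (s : Finset ι) (u a b : ι → ℝ) (d : ℕ) (T : Finset ℝ)
    (hT : d < #T) (h : ∀ t ∈ T, ∑ i ∈ s, u i * (a i + b i * t) ^ d = 0) (t : ℝ) :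
    ∑ i ∈ s, u i * (a i + b i * t) ^ d = 0 := by
  set f : ℝ[X] := ∑ i ∈ s, C (u i) * (C (a i) + C (b i) * X) ^ d with hf
  have heval (t : ℝ) : f.eval t = ∑ i ∈ s, u i * (a i + b i * t) ^ d := by
    simp [hf, eval_finsetSum]
  have hdeg : f.natDegree ≤ d := by
    refine natDegree_sum_le_of_forall_le _ _ fun i _ ↦ ?_
    compute_degree
  have hzero : f = 0 := eq_zero_of_natDegree_lt_card_of_eval_eq_zero' f T
    (fun t ht ↦ by rw [heval, h t ht]) (hdeg.trans_lt hT)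
  rw [← heval, hzero, eval_zero]

open Module Finset Polynomial in
/-- The `t`-derivative at `0` of an identically vanishing weighted power sum. -/
theorem sum_mul_pow_eq_zero_of_pencil {ι : Type*} (s : Finset ι) (u a b : ι → ℝ) (d : ℕ)
    (h : ∀ t : ℝ, ∑ i ∈ s, u i * (a i + b i * t) ^ (d + 1) = 0) :
    ∑ i ∈ s, u i * b i * a i ^ d = 0 := by
  have hf : ∑ i ∈ s, C (u i) * (C (a i) + C (b i) * X) ^ (d + 1) = 0 := by
    refine Polynomial.funext fun t ↦ ?_
    simpa [eval_finsetSum] using h t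
  have hder := congr_arg (fun f : ℝ[X] ↦ (derivative f).eval 0) hf
  simp only [derivative_sum, eval_finsetSum, derivative_zero, eval_zero] at hder
  have hd : ((d : ℝ) + 1) ≠ 0 := by positivity
  refine (mul_eq_zero.1 ((?_ : ((d : ℝ) + 1) * _ = 0))).resolve_left hd
  rw [← hder, mul_sum]
  refine sum_congr rfl fun i _ ↦ ?_
  simp [derivative_pow]
  ring

open Module Finset in
/-- If a weighted sum of `d`-th powers of linear forms vanishes on the hyperplanes of the dual space
that annihilate one of more than `d` pairwise non-proportional vectors, then it vanishes
identically. -/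
theorem sum_dual_pow_eq_zero {ι κ E : Type*} [AddCommGroup E] [Module ℝ E] (s : Finset ι)
    (u : ι → ℝ) (v : ι → E) (B : Finset κ) (r : κ → E) (d : ℕ) (hd : d < #B)
    (hr : ∀ b ∈ B, r b ≠ 0)
    (hrr : ∀ b ∈ B, ∀ c ∈ B, b ≠ c → ∀ x y : ℝ, x • r b = y • r c → y = 0)
    (h : ∀ b ∈ B, ∀ l : Dual ℝ E, l (r b) = 0 → ∑ i ∈ s, u i * l (v i) ^ d = 0)
    (l : Dual ℝ E) : ∑ i ∈ s, u i * l (v i) ^ d = 0 := by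
  classical
  by_cases hl : ∃ b ∈ B, l (r b) = 0
  · obtain ⟨b, hb, hlb⟩ := hl
    exact h b hb l hlb
  push Not at hl
  obtain ⟨m, hm⟩ := exists_dual_forall_apply_ne_zero (K := ℝ)
    (fun z : B × B ↦ if z.1 = z.2 then r z.1 else l (r z.1) • r z.2 - l (r z.2) • r z.1) (by
      rintro ⟨⟨b, hb⟩, ⟨c, hc⟩⟩
      by_cases hbc : b = c
      · simpa [hbc] using hr c hc
      · simpa [hbc] using fun hz ↦ hl c hc (hrr c hc b hb (Ne.symm hbc) _ _ (sub_eq_zero.1 hz)))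
  have hm_ne (b) (hb : b ∈ B) : m (r b) ≠ 0 := by simpa using hm (⟨b, hb⟩, ⟨b, hb⟩)
  have hinj : Set.InjOn (fun b ↦ -l (r b) / m (r b)) B := by
    intro b hb c hc hbc
    by_contra hne
    have hbm := hm_ne b hb
    have hcm := hm_ne c hc
    have hbc_ne := hm (⟨b, hb⟩, ⟨c, hc⟩)
    simp only [Subtype.mk.injEq, if_neg hne, map_sub, map_smul, smul_eq_mul] at hbc_ne
    refine hbc_ne ?_
    field_simp at hbc
    linarith
  have key := sum_pow_pencil_eq_zero s u (fun i ↦ l (v i)) (fun i ↦ m (v i)) d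
    (B.image fun b ↦ -l (r b) / m (r b)) (by rwa [card_image_of_injOn hinj]) (by
      simp only [mem_image, forall_exists_index, and_imp]
      rintro _ b hb rfl
      have hbm := hm_ne b hb
      have := h b hb (l + (-l (r b) / m (r b)) • m) (by simp; field_simp; ring)
      simpa [mul_comm] using this) 0
  simpa using key

open Module Finset in
/-- If any two of the vectors `v i`, `i ∈ T`, are annihilated by a form not vanishing at `v c`, then
a linear relation between the `d`-th powers of `v c` and of the `v i`, `i ∈ T`, does not involve
`v c` as soon as `#T ≤ 2 * d`. -/
theorem coeff_eq_zero_of_sum_dual_pow_eq_zero {ι E : Type*} [AddCommGroup E] [Module ℝ E]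
    (v : ι → E) (c : ι) (d : ℕ) (T : Finset ι) (u : ι → ℝ) (hT : #T ≤ 2 * d)
    (hsep : ∀ p ∈ T, ∀ q ∈ T, ∃ g : Dual ℝ E, g (v p) = 0 ∧ g (v q) = 0 ∧ g (v c) ≠ 0)
    (hvc : v c ≠ 0)
    (h : ∀ l : Dual ℝ E, u c * l (v c) ^ d + ∑ i ∈ T, u i * l (v i) ^ d = 0) : u c = 0 := by
  classical
  induction d generalizing T u with
  | zero =>
    obtain rfl : T = ∅ := by simpa using hT
    simpa using h 0
  | succ d ih =>
    have hstep (g : Dual ℝ E) (l : Dual ℝ E) :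
        u c * g (v c) * l (v c) ^ d + ∑ i ∈ T, u i * g (v i) * l (v i) ^ d = 0 := by
      have := sum_mul_pow_eq_zero_of_pencil (insertNone T) (fun i ↦ u (i.getD c))
        (fun i ↦ l (v (i.getD c))) (fun i ↦ g (v (i.getD c))) d (fun t ↦ by
          simpa [sum_insertNone, mul_comm] using h (l + t • g))
      simpa [sum_insertNone] using this
    obtain ⟨g, hgc, T', hT'T, hT', hg⟩ : ∃ g : Dual ℝ E, g (v c) ≠ 0 ∧ ∃ T' ⊆ T, #T' ≤ 2 * d ∧
        ∀ i ∈ T, i ∉ T' → g (v i) = 0 := by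
      rcases T.eq_empty_or_nonempty with rfl | ⟨p, hp⟩
      · obtain ⟨g, hg⟩ := exists_dual_forall_apply_ne_zero (K := ℝ) (fun _ : Unit ↦ v c)
          fun _ ↦ hvc
        exact ⟨g, hg (), ∅, by simp⟩
      rcases (T.erase p).eq_empty_or_nonempty with h0 | ⟨q, hq⟩
      · obtain ⟨g, hgp, -, hgc⟩ := hsep p hp p hp
        refine ⟨g, hgc, T.erase p, erase_subset _ _, by simp [h0], fun i hi hi' ↦ ?_⟩
        obtain rfl : i = p := by simpa [hi] using hi'
        exact hgp
      · obtain ⟨g, hgp, hgq, hgc⟩ := hsep p hp q (mem_of_mem_erase hq)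
        refine ⟨g, hgc, (T.erase p).erase q, (erase_subset _ _).trans (erase_subset _ _), ?_,
          fun i hi hi' ↦ ?_⟩
        · rw [card_erase_of_mem hq, card_erase_of_mem hp]
          lia
        · by_cases hiq : i = q
          · rwa [hiq]
          · obtain rfl : i = p := by simpa [hi, hiq] using hi'
            exact hgp
    have := ih T' (fun i ↦ u i * g (v i)) hT'
      (fun p hp q hq ↦ hsep p (hT'T hp) q (hT'T hq)) fun l ↦ by
        rw [← hstep g l, sum_subset hT'T fun i hi hi' ↦ by simp [hg i hi hi']]
    exact (mul_eq_zero.1 this).resolve_right hgc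

/-- The linear form on `ℝ² × ℝ` whose value at `(x, 1)` is twice the signed area of `p q x`. -/
def areaForm (p q : ℝ × ℝ) : Module.Dual ℝ ((ℝ × ℝ) × ℝ) where
  toFun x := (q.1 - p.1) * (x.1.2 - p.2 * x.2) - (q.2 - p.2) * (x.1.1 - p.1 * x.2)
  map_add' x y := by simp only [Prod.fst_add, Prod.snd_add]; ring
  map_smul' c x := by
    simp only [Prod.smul_fst, Prod.smul_snd, smul_eq_mul, RingHom.id_apply]; ring

theorem areaForm_apply (p q x : ℝ × ℝ) :
    areaForm p q (x, 1) = (q.1 - p.1) * (x.2 - p.2) - (q.2 - p.2) * (x.1 - p.1) := by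
  simp [areaForm]

theorem areaForm_self_left (p q : ℝ × ℝ) : areaForm p q (p, 1) = 0 := by
  rw [areaForm_apply]; ring

theorem areaForm_self_right (p q : ℝ × ℝ) : areaForm p q (q, 1) = 0 := by
  rw [areaForm_apply]; ring

theorem collinear_of_areaForm_eq_zero {p q x : ℝ × ℝ} (hpq : p ≠ q)
    (h : areaForm p q (x, 1) = 0) : Collinear ℝ ({p, q, x} : Set (ℝ × ℝ)) := by
  rw [areaForm_apply] at h
  rw [collinear_iff_of_mem (Set.mem_insert p _)]
  refine ⟨q - p, ?_⟩
  simp only [Set.mem_insert_iff, Set.mem_singleton_iff, forall_eq_or_imp, forall_eq]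
  refine ⟨⟨0, by simp⟩, ⟨1, by simp⟩, ?_⟩
  by_cases h1 : q.1 - p.1 = 0
  · have h2 : q.2 - p.2 ≠ 0 := fun h2 ↦
      hpq (Prod.ext (sub_eq_zero.1 h1).symm (sub_eq_zero.1 h2).symm)
    refine ⟨(x.2 - p.2) / (q.2 - p.2), Prod.ext ?_ ?_⟩ <;> simp <;> field_simp <;> linarith
  · refine ⟨(x.1 - p.1) / (q.1 - p.1), Prod.ext ?_ ?_⟩ <;> simp <;> field_simp <;> linarith

theorem map_lineMap_one (l : Module.Dual ℝ ((ℝ × ℝ) × ℝ)) (p q : ℝ × ℝ) (t : ℝ) :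
    l (AffineMap.lineMap p q t, 1) = (1 - t) * l (p, 1) + t * l (q, 1) := by
  rw [← smul_eq_mul, ← smul_eq_mul, ← map_smul, ← map_smul, ← map_add,
    AffineMap.lineMap_apply_module]
  simp

/-- Two points of a set in general position whose joins with a third point of the set pass through
a common point outside the set coincide. -/
theorem GenPos.eq_of_lineMap_eq {P : Finset (ℝ × ℝ)} (hgen : GenPos P) {p q q' : ℝ × ℝ}
    (hp : p ∈ P) (hq : q ∈ P) (hq' : q' ∈ P) (hpq : p ≠ q) (hpq' : p ≠ q') {t t' : ℝ} (ht : t' ≠ 0)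
    (h : AffineMap.lineMap p q t = (AffineMap.lineMap p q' t' : ℝ × ℝ)) : q = q' := by
  by_contra hne
  refine hgen p hp q hq q' hq' hpq hpq' hne (collinear_of_areaForm_eq_zero hpq ?_)
  have h1 := map_lineMap_one (areaForm p q) p q t
  rw [h, map_lineMap_one, areaForm_self_left, areaForm_self_right] at h1
  simpa [ht] using h1

open Module Finset in
/-- A Menelaus-type relation: if `#B + 1 = #P` and the blocking point `β p q` of the line `p q` has
barycentric coordinates `lam q p` and `lam p q` with respect to `p` and `q`, then these coordinates
are proportional to the products of the coordinates attached to `p` and to `q`. -/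
theorem prod_mul_eq_prod_mul {P B : Finset (ℝ × ℝ)} (hgen : GenPos P) (hB : #B + 1 = #P)
    (β : ℝ × ℝ → ℝ × ℝ → ℝ × ℝ) (lam : ℝ × ℝ → ℝ × ℝ → ℝ)
    (hβ : ∀ p ∈ P, ∀ q ∈ P, p ≠ q → β p q ∈ B ∧ β q p = β p q ∧ lam q p = 1 - lam p q ∧
      β p q = AffineMap.lineMap p q (lam p q))
    (himage : ∀ p ∈ P, (P.erase p).image (β p) = B)
    {p q : ℝ × ℝ} (hp : p ∈ P) (hq : q ∈ P) (hpq : p ≠ q) :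
    lam q p * ∏ k ∈ P.erase p, lam p k = lam p q * ∏ k ∈ P.erase q, lam q k := by
  classical
  have hinj (p) (hp : p ∈ P) : Set.InjOn (β p) (P.erase p) := by
    rw [← card_image_iff, himage p hp, card_erase_of_mem hp]
    lia
  have key (p q) (hp : p ∈ P) (hq : q ∈ P) (hpq : p ≠ q) (l : Dual ℝ ((ℝ × ℝ) × ℝ))
      (hl : l (p, 1) = 0) :
      (∏ k ∈ (P.erase p).erase q, lam p k) * ∏ k ∈ (P.erase p).erase q, l (k, 1) =
        ∏ b ∈ B.erase (β p q), l (b, 1) := by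
    rw [← prod_mul_distrib]
    refine prod_nbij (β p) ?_ ?_ ?_ ?_
    · intro k hk
      simp only [mem_erase] at hk ⊢
      refine ⟨fun h ↦ hk.1 (hinj p hp ?_ ?_ h), (hβ p hp k hk.2.2 (Ne.symm hk.2.1)).1⟩
      · exact mem_coe.2 (mem_erase.2 hk.2)
      · exact mem_coe.2 (mem_erase.2 ⟨hpq.symm, hq⟩)
    · exact (hinj p hp).mono (coe_subset.2 (erase_subset _ _))
    · intro b hb
      obtain ⟨hbq, hb⟩ := mem_erase.1 (mem_coe.1 hb)
      obtain ⟨k, hk, rfl⟩ := mem_image.1 ((himage p hp).symm ▸ hb)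
      exact ⟨k, mem_coe.2 (mem_erase.2 ⟨fun h ↦ hbq (congrArg _ h), hk⟩), rfl⟩
    · intro k hk
      simp only [mem_erase] at hk
      rw [(hβ p hp k hk.2.2 (Ne.symm hk.2.1)).2.2.2, map_lineMap_one, hl]
      ring
  have h1 := key p q hp hq hpq (areaForm p q) (areaForm_self_left p q)
  have h2 := key q p hq hp hpq.symm (areaForm p q) (areaForm_self_right p q)
  rw [(hβ p hp q hq hpq).2.1, ← h1, erase_right_comm] at h2
  have hne : ∏ k ∈ (P.erase p).erase q, areaForm p q (k, 1) ≠ 0 := by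
    refine prod_ne_zero_iff.2 fun k hk h0 ↦ ?_
    simp only [mem_erase] at hk
    exact hgen p hp q hq k hk.2.2 hpq (Ne.symm hk.2.1) (Ne.symm hk.1)
      (collinear_of_areaForm_eq_zero hpq h0)
  have h3 := mul_right_cancel₀ hne h2
  rw [← mul_prod_erase (P.erase p) (lam p) (mem_erase.2 ⟨hpq.symm, hq⟩),
    ← mul_prod_erase (P.erase q) (lam q) (mem_erase.2 ⟨hpq, hp⟩), erase_right_comm (a := q), h3]
  ring

open Module Finset in
/-- A set of at least five points in general position is not blocked by a set with one point
fewer for which the blocking points pair up the blocked ones. -/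
theorem false_of_card_add_one_eq {P B : Finset (ℝ × ℝ)} (hgen : GenPos P) (hB : #B + 1 = #P)
    (hP : 5 ≤ #P)
    (β : ℝ × ℝ → ℝ × ℝ → ℝ × ℝ) (lam : ℝ × ℝ → ℝ × ℝ → ℝ)
    (hβ : ∀ p ∈ P, ∀ q ∈ P, p ≠ q → β p q ∈ B ∧ β q p = β p q ∧ lam q p = 1 - lam p q ∧
      β p q = AffineMap.lineMap p q (lam p q))
    (hlam : ∀ p ∈ P, ∀ q ∈ P, p ≠ q → lam p q ≠ 0)
    (himage : ∀ p ∈ P, (P.erase p).image (β p) = B) : False := by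
  classical
  have hinj (p) (hp : p ∈ P) : Set.InjOn (β p) (P.erase p) := by
    rw [← card_image_iff, himage p hp, card_erase_of_mem hp]
    lia
  have hpartner (b) (hb : b ∈ B) (p) (hp : p ∈ P) : ∃ q ∈ P, p ≠ q ∧ β p q = b := by
    rw [← himage p hp, mem_image] at hb
    obtain ⟨q, hq, rfl⟩ := hb
    exact ⟨q, mem_of_mem_erase hq, (ne_of_mem_erase hq).symm, rfl⟩
  choose! σ hσ hσ_ne hσ_eq using hpartner
  have hσσ (b) (hb : b ∈ B) (p) (hp : p ∈ P) : σ b (σ b p) = p := by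
    have hq := hσ b hb p hp
    refine hinj _ hq ?_ ?_ ?_
    · exact mem_coe.2 (mem_erase.2 ⟨(hσ_ne b hb _ hq).symm, hσ b hb _ hq⟩)
    · exact mem_coe.2 (mem_erase.2 ⟨hσ_ne b hb p hp, hp⟩)
    · rw [hσ_eq b hb _ hq, (hβ p hp _ hq (hσ_ne b hb p hp)).2.1, hσ_eq b hb p hp]
  obtain ⟨b₀, hb₀⟩ : B.Nonempty := card_pos.1 (by lia)
  have heven : Even #P := by
    have h : ∑ p ∈ P, (1 : ZMod 2) = 0 :=
      sum_involution (fun p _ ↦ σ b₀ p) (fun _ _ ↦ by decide)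
        (fun p hp _ ↦ (hσ_ne b₀ hb₀ p hp).symm) (fun p hp ↦ hσ b₀ hb₀ p hp)
        (fun p hp ↦ hσσ b₀ hb₀ p hp)
    rw [sum_const, nsmul_one] at h
    exact (ZMod.natCast_eq_zero_iff_even).1 h
  set c : ℝ × ℝ → ℝ := fun p ↦ ∏ k ∈ P.erase p, lam p k
  have hc_ne (p) (hp : p ∈ P) : c p ≠ 0 := prod_ne_zero_iff.2 fun k hk ↦
    hlam p hp k (mem_of_mem_erase hk) (ne_of_mem_erase hk).symm
  set d := #P - 3 with hd
  have hdodd : Odd d := by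
    obtain ⟨m, hm⟩ := heven
    exact ⟨m - 2, by lia⟩
  have hvanish (l : Dual ℝ ((ℝ × ℝ) × ℝ)) :
      ∑ p ∈ P, (c p)⁻¹ ^ d * l (p, 1) ^ d = 0 := by
    refine sum_dual_pow_eq_zero P _ (fun p ↦ (p, 1)) B (fun b ↦ (b, 1)) d (by lia) (by simp) ?_ ?_ l
    · rintro b - b' - hbb' x y hxy
      simp only [Prod.smul_mk, Prod.mk.injEq, smul_eq_mul, mul_one] at hxy
      obtain ⟨hxy, rfl⟩ := hxy
      by_contra hx
      exact hbb' (smul_right_injective _ hx hxy)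
    · intro b hb l hl
      refine sum_involution (fun p _ ↦ σ b p) (fun p hp ↦ ?_)
        (fun p hp _ ↦ (hσ_ne b hb p hp).symm) (fun p hp ↦ hσ b hb p hp)
        (fun p hp ↦ hσσ b hb p hp)
      have hq := hσ b hb p hp
      have hpq := hσ_ne b hb p hp
      have hbq := hσ_eq b hb p hp
      set q := σ b p
      obtain ⟨-, -, hlam', hline⟩ := hβ p hp q hq hpq
      rw [← hbq, hline, map_lineMap_one, ← hlam'] at hl
      have hmen := prod_mul_eq_prod_mul hgen hB β lam hβ himage hp hq hpq
      change lam q p * c p = lam p q * c q at hmen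
      have hcp := hc_ne p hp
      have hcq := hc_ne q hq
      have hopp : (c q)⁻¹ * l (q, 1) = -((c p)⁻¹ * l (p, 1)) := by
        field_simp
        refine mul_left_cancel₀ (hlam p hp q hq hpq) ?_
        linear_combination c p * hl - l (p, 1) * hmen
      rw [← mul_pow, ← mul_pow, hopp, hdodd.neg_pow, add_neg_cancel]
  obtain ⟨x, hx⟩ : P.Nonempty := card_pos.1 (by lia)
  refine pow_ne_zero d (inv_ne_zero (hc_ne x hx)) (coeff_eq_zero_of_sum_dual_pow_eq_zero
    (fun p : ℝ × ℝ ↦ ((p, 1) : (ℝ × ℝ) × ℝ)) x d (P.erase x) (fun p ↦ (c p)⁻¹ ^ d)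
    (by rw [card_erase_of_mem hx]; lia) ?_ (by simp)
    fun l ↦ by rw [add_sum_erase P (fun p ↦ (c p)⁻¹ ^ d * l (p, 1) ^ d) hx, hvanish])
  have harea (p q) (hp : p ∈ P.erase x) (hq : q ∈ P.erase x) (hpq : p ≠ q) :
      areaForm p q (x, 1) ≠ 0 := fun h0 ↦ hgen p (mem_of_mem_erase hp) q (mem_of_mem_erase hq) x hx
        hpq (ne_of_mem_erase hp) (ne_of_mem_erase hq) (collinear_of_areaForm_eq_zero hpq h0)
  intro p hp q hq
  by_cases hpq : p = q
  · obtain ⟨k, hk, hkp⟩ := exists_mem_ne (s := P.erase x)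
      (by rw [card_erase_of_mem hx]; lia) p
    exact ⟨areaForm p k, areaForm_self_left p k, hpq ▸ areaForm_self_left p k,
      harea p k hp hk hkp.symm⟩
  · exact ⟨areaForm p q, areaForm_self_left p q, areaForm_self_right p q, harea p q hp hq hpq⟩

/-- If `P` is a set of `n ≥ 5` points in general position and `B` (disjoint from `P`)
blocks every line spanned by `P`, then `|B| ≥ n`. -/
theorem blocking_points_lower_bound (n : ℕ) (hn : 5 ≤ n) (P B : Finset (ℝ × ℝ))
    (hPcard : P.card = n) (hgen : GenPos P) (hdisj : B ∩ P = ∅)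
    (hblock : Blocks B P) : n ≤ B.card := by
  classical
  subst hPcard
  by_contra! hlt
  have hex (p q : ℝ × ℝ) (hp : p ∈ P) (hq : q ∈ P) (hpq : p ≠ q) :
      ∃ b ∈ B, ∃ t : ℝ, b = AffineMap.lineMap p q t := by
    obtain ⟨b, hb, hbl⟩ := hblock p hp q hq hpq
    obtain ⟨t, ht⟩ := mem_affineSpan_pair_iff_exists_lineMap_eq.1 hbl
    exact ⟨b, hb, t, ht.symm⟩
  choose! β hβ lam hlam using hex
  have hparam {p q : ℝ × ℝ} {t : ℝ} (hp : p ∈ P) (hb : AffineMap.lineMap p q t ∈ B) : t ≠ 0 := by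
    rintro rfl
    have : p ∈ B ∩ P := Finset.mem_inter.2 ⟨by simpa using hb, hp⟩
    simp [hdisj] at this
  have hinj (p) (hp : p ∈ P) : Set.InjOn (β p) (P.erase p) := by
    intro q hq q' hq' h
    simp only [Finset.coe_erase, Set.mem_sdiff, Finset.mem_coe, Set.mem_singleton_iff] at hq hq'
    have hpq := Ne.symm hq.2
    have hpq' := Ne.symm hq'.2
    rw [hlam p q hp hq.1 hpq, hlam p q' hp hq'.1 hpq'] at h
    exact hgen.eq_of_lineMap_eq hp hq.1 hq'.1 hpq hpq'
      (hparam hp (hlam p q' hp hq'.1 hpq' ▸ hβ p q' hp hq'.1 hpq')) h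
  have hmaps (p) (hp : p ∈ P) : (P.erase p).image (β p) ⊆ B := by
    intro b hb
    obtain ⟨q, hq, rfl⟩ := Finset.mem_image.1 hb
    exact hβ p q hp (Finset.mem_of_mem_erase hq) (Finset.ne_of_mem_erase hq).symm
  have himage (p) (hp : p ∈ P) : (P.erase p).image (β p) = B :=
    Finset.eq_of_subset_of_card_le (hmaps p hp) (by
      rw [Finset.card_image_of_injOn (hinj p hp), Finset.card_erase_of_mem hp]
      lia)
  have hcard : B.card + 1 = P.card := by
    obtain ⟨p, hp⟩ : P.Nonempty := Finset.card_pos.1 (by lia)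
    rw [← himage p hp, Finset.card_image_of_injOn (hinj p hp), Finset.card_erase_of_mem hp]
    lia
  have huniq {p q : ℝ × ℝ} {t : ℝ} (hp : p ∈ P) (hq : q ∈ P) (hpq : p ≠ q)
      (hb : AffineMap.lineMap p q t ∈ B) : β p q = AffineMap.lineMap p q t := by
    obtain ⟨q', hq', h⟩ := Finset.mem_image.1 (himage p hp ▸ hb)
    have hq'P := Finset.mem_of_mem_erase hq'
    have hpq' := (Finset.ne_of_mem_erase hq').symm
    rw [← h]
    rw [hlam p q' hp hq'P hpq'] at h
    rw [hgen.eq_of_lineMap_eq hp hq'P hq hpq' hpq (hparam hp hb) h]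
  refine false_of_card_add_one_eq hgen hcard hn β lam (fun p hp q hq hpq ↦ ?_)
    (fun p hp q hq hpq ↦ hparam hp (hlam p q hp hq hpq ▸ hβ p q hp hq hpq)) himage
  have h1 := hlam p q hp hq hpq
  have h2 := hβ q p hq hp hpq.symm
  rw [hlam q p hq hp hpq.symm, ← AffineMap.lineMap_apply_one_sub] at h2
  have h3 : β q p = β p q := by
    rw [huniq hp hq hpq h2, hlam q p hq hp hpq.symm, AffineMap.lineMap_apply_one_sub]
  refine ⟨hβ p q hp hq hpq, h3, ?_, h1⟩
  rw [h1, hlam q p hq hp hpq.symm, ← AffineMap.lineMap_apply_one_sub] at h3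
  have := AffineMap.lineMap_injective ℝ hpq h3
  linarith
end

section
/- Let n ≥ 3 be odd and let P be a set of n points in the real plane in general position. Let B be a finite set of points with B ∩ P = ∅ that blocks P, i.e., every line through two distinct points of P contains a point of B. Then |B| ≥ n. -/
open Classical in
/-- The ordered pairs of distinct points of `P` whose line passes through `b`. -/
noncomputable def blockedPairs (P : Finset (ℝ × ℝ)) (b : ℝ × ℝ) :
    Finset ((ℝ × ℝ) × (ℝ × ℝ)) :=
  P.offDiag.filter fun x => b ∈ affineSpan ℝ ({x.1, x.2} : Set (ℝ × ℝ))

theorem mem_blockedPairs {P : Finset (ℝ × ℝ)} {b : ℝ × ℝ} {x : (ℝ × ℝ) × (ℝ × ℝ)} :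
    x ∈ blockedPairs P b ↔ (x.1 ∈ P ∧ x.2 ∈ P ∧ x.1 ≠ x.2) ∧
      b ∈ affineSpan ℝ ({x.1, x.2} : Set (ℝ × ℝ)) := by
  simp [blockedPairs]

theorem even_card_blockedPairs (P : Finset (ℝ × ℝ)) (b : ℝ × ℝ) :
    Even (blockedPairs P b).card := by
  rw [← ZMod.natCast_eq_zero_iff_even, Finset.cast_card]
  refine Finset.sum_involution (fun x _ => x.swap) ?_ ?_ ?_ ?_
  · intro x _
    decide
  · intro x hx _ h
    exact (mem_blockedPairs.1 hx).1.2.2 (congrArg Prod.snd h)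
  · intro x hx
    obtain ⟨⟨h₁, h₂, hne⟩, hb⟩ := mem_blockedPairs.1 hx
    exact mem_blockedPairs.2 ⟨⟨h₂, h₁, hne.symm⟩, by simpa [Set.pair_comm] using hb⟩
  · intro x _
    exact x.swap_swap

/-- If the lines `pq` and `pr` share a point other than `p`, then `p, q, r` are collinear. -/
theorem collinear_of_mem_affineSpan_pairs {b p q r : ℝ × ℝ} (hbp : b ≠ p)
    (hq : b ∈ affineSpan ℝ ({p, q} : Set (ℝ × ℝ)))
    (hr : b ∈ affineSpan ℝ ({p, r} : Set (ℝ × ℝ))) :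
    Collinear ℝ ({p, q, r} : Set (ℝ × ℝ)) := by
  have key : ∀ s, b ∈ affineSpan ℝ ({p, s} : Set (ℝ × ℝ)) →
      s ∈ affineSpan ℝ ({p, b} : Set (ℝ × ℝ)) := by
    intro s hs
    have hcol : Collinear ℝ ({b, p, s} : Set (ℝ × ℝ)) :=
      collinear_insert_of_mem_affineSpan_pair hs
    exact hcol.mem_affineSpan_of_mem_of_ne (by simp) (by simp) (by simp) hbp.symm
  exact collinear_triple_of_mem_affineSpan_pair (left_mem_affineSpan_pair ℝ p b)
    (key q hq) (key r hr)

theorem card_blockedPairs_le {P : Finset (ℝ × ℝ)} (hgen : GenPos P) {b : ℝ × ℝ} (hb : b ∉ P) :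
    (blockedPairs P b).card ≤ P.card := by
  refine Finset.card_le_card_of_injOn Prod.fst (fun x hx => (mem_blockedPairs.1 hx).1.1) ?_
  rintro ⟨p, q⟩ hx ⟨p', r⟩ hy (rfl : p = p')
  obtain ⟨⟨hp, hq, hpq⟩, hbq⟩ := mem_blockedPairs.1 hx
  obtain ⟨⟨-, hr, hpr⟩, hbr⟩ := mem_blockedPairs.1 hy
  by_contra hne
  have hqr : q ≠ r := fun h => hne (by rw [h])
  exact hgen p hp q hq r hr hpq hpr hqr
    (collinear_of_mem_affineSpan_pairs (fun h : b = p => hb (h ▸ hp)) hbq hbr)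

/-- If `P` is a set of `n ≥ 3` points, `n` odd, in general position and `B`
(disjoint from `P`) blocks `P`, then `|B| ≥ n`. -/
theorem blocking_points_odd_ge (n : ℕ) (hn : 3 ≤ n) (hodd : Odd n) (P B : Finset (ℝ × ℝ))
    (hPcard : P.card = n) (hgen : GenPos P) (hdisj : B ∩ P = ∅)
    (hblock : Blocks B P) : n ≤ B.card := by
  have hfiber : ∀ b ∈ B, (blockedPairs P b).card ≤ n - 1 := by
    intro b hb
    have hbP : b ∉ P := fun h => by
      have : b ∈ B ∩ P := Finset.mem_inter.2 ⟨hb, h⟩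
      simp [hdisj] at this
    have hle := card_blockedPairs_le hgen hbP
    obtain ⟨k, hk⟩ := even_card_blockedPairs P b
    obtain ⟨m, hm⟩ := hodd
    omega
  have hcover : P.offDiag ⊆ B.biUnion (blockedPairs P) := by
    intro x hx
    obtain ⟨h₁, h₂, hne⟩ := Finset.mem_offDiag.1 hx
    obtain ⟨b, hb, hbx⟩ := hblock _ h₁ _ h₂ hne
    exact Finset.mem_biUnion.2 ⟨b, hb, mem_blockedPairs.2 ⟨⟨h₁, h₂, hne⟩, hbx⟩⟩
  have hcount : n * (n - 1) ≤ B.card * (n - 1) := by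
    calc n * (n - 1) = P.offDiag.card := by
          rw [Finset.offDiag_card, hPcard, Nat.mul_sub, mul_one]
      _ ≤ (B.biUnion (blockedPairs P)).card := Finset.card_le_card hcover
      _ ≤ B.card * (n - 1) := Finset.card_biUnion_le_card_mul _ _ _ hfiber
  exact Nat.le_of_mul_le_mul_right hcount (by omega)
end

section
/- For every n ≥ 3 there exist a set P of n points in the real plane in general position and a set B of n points with B ∩ P = ∅ such that every line through two distinct points of P contains a point of B. -/
open Real in
/-- The conic `θ ↦ (1, sin θ cos θ, 1 + cos² θ)` in an affine chart in which the secant lines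
meet the axis `x = 0` at the points `(0, -cot (α + β))`. -/
noncomputable def conicPoint (θ : ℝ) : ℝ × ℝ :=
  (1 / (1 + cos θ ^ 2), sin θ * cos θ / (1 + cos θ ^ 2))

open Real in
/-- The point of the axis `x = 0` with ordinate `-cot φ`. -/
noncomputable def axisPoint (φ : ℝ) : ℝ × ℝ :=
  (0, -(cos φ / sin φ))

open Real in
theorem one_add_cos_sq_pos (θ : ℝ) : 0 < 1 + cos θ ^ 2 := by positivity

open Real in
theorem cos_sq_sub_cos_sq (α β : ℝ) :
    cos α ^ 2 - cos β ^ 2 = -(sin (α + β) * sin (α - β)) := by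
  rw [sin_add, sin_sub]
  linear_combination (-cos α ^ 2) * sin_sq_add_cos_sq β + cos β ^ 2 * sin_sq_add_cos_sq α

open Real in
theorem sin_mul_cos_sub_sin_mul_cos (α β : ℝ) :
    sin α * cos α - sin β * cos β = cos (α + β) * sin (α - β) := by
  rw [cos_add, sin_sub]
  linear_combination (-sin α * cos α) * sin_sq_add_cos_sq β
    + sin β * cos β * sin_sq_add_cos_sq α

open Real in
theorem cos_sq_ne_cos_sq {α β : ℝ} (hadd : sin (α + β) ≠ 0) (hsub : sin (α - β) ≠ 0) :
    cos α ^ 2 - cos β ^ 2 ≠ 0 := by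
  rw [cos_sq_sub_cos_sq]
  exact neg_ne_zero.mpr (mul_ne_zero hadd hsub)

open Real in
theorem conicPoint_ne {α β : ℝ} (hadd : sin (α + β) ≠ 0) (hsub : sin (α - β) ≠ 0) :
    conicPoint α ≠ conicPoint β := by
  intro h
  have h1 := congrArg Prod.fst h
  simp only [conicPoint, one_div] at h1
  have h2 := inv_injective h1
  exact cos_sq_ne_cos_sq hadd hsub (by linarith)

open Real in
theorem axisPoint_ne {α β : ℝ} (hα : sin α ≠ 0) (hβ : sin β ≠ 0) (hsub : sin (α - β) ≠ 0) :
    axisPoint α ≠ axisPoint β := by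
  intro h
  have h1 := congrArg Prod.snd h
  simp only [axisPoint, neg_inj] at h1
  rw [div_eq_div_iff hα hβ] at h1
  apply hsub
  rw [sin_sub]
  linarith

open Real in
theorem axisPoint_add_pi (φ : ℝ) : axisPoint (φ + π) = axisPoint φ := by
  simp [axisPoint]

open Real in
theorem axisPoint_ne_conicPoint (φ θ : ℝ) : axisPoint φ ≠ conicPoint θ := by
  intro h
  have h1 := congrArg Prod.fst h
  simp only [axisPoint, conicPoint] at h1
  exact (one_div_pos.mpr (one_add_cos_sq_pos θ)).ne h1

open Real in
theorem axisPoint_mem_secant {α β : ℝ} (hadd : sin (α + β) ≠ 0) (hsub : sin (α - β) ≠ 0) :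
    axisPoint (α + β) ∈ affineSpan ℝ ({conicPoint α, conicPoint β} : Set (ℝ × ℝ)) := by
  have hα := (one_add_cos_sq_pos α).ne'
  have hβ := (one_add_cos_sq_pos β).ne'
  have hd := cos_sq_ne_cos_sq hadd hsub
  have hcot : -(cos (α + β) / sin (α + β))
      = (sin α * cos α - sin β * cos β) / (cos α ^ 2 - cos β ^ 2) := by
    rw [sin_mul_cos_sub_sin_mul_cos, cos_sq_sub_cos_sq]
    field_simp
  have h := AffineMap.lineMap_mem_affineSpan_pair (k := ℝ)
    (-(1 + cos β ^ 2) / (cos α ^ 2 - cos β ^ 2)) (conicPoint α) (conicPoint β)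
  convert h using 1
  rw [AffineMap.lineMap_apply, axisPoint, hcot]
  ext
  · simp only [conicPoint, vsub_eq_sub, vadd_eq_add, Prod.fst_add, Prod.smul_fst, Prod.fst_sub,
      smul_eq_mul]
    field_simp
    ring
  · simp only [conicPoint, vsub_eq_sub, vadd_eq_add, Prod.snd_add, Prod.smul_snd, Prod.snd_sub,
      smul_eq_mul]
    field_simp
    ring

open Real in
theorem not_collinear_conicPoint {α β γ : ℝ} (hαβ : sin (α - β) ≠ 0) (hαγ : sin (α - γ) ≠ 0)
    (hβγ : sin (β - γ) ≠ 0) :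
    ¬ Collinear ℝ ({conicPoint α, conicPoint β, conicPoint γ} : Set (ℝ × ℝ)) := by
  intro h
  obtain ⟨⟨x₀, y₀⟩, ⟨u, v⟩, h⟩ := (collinear_iff_exists_forall_eq_smul_vadd (k := ℝ) _).1 h
  obtain ⟨r, hr⟩ := h (conicPoint α) (by simp)
  obtain ⟨s, hs⟩ := h (conicPoint β) (by simp)
  obtain ⟨t, ht⟩ := h (conicPoint γ) (by simp)
  simp only [conicPoint, vadd_eq_add, Prod.smul_mk, Prod.mk_add_mk, smul_eq_mul,
    Prod.mk.injEq] at hr hs ht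
  rw [div_eq_iff (one_add_cos_sq_pos _).ne', div_eq_iff (one_add_cos_sq_pos _).ne'] at hr hs ht
  have hdet : ∀ p q p' q' p'' q'' : ℝ,
      1 = (r * u + x₀) * q ∧ p = (r * v + y₀) * q →
      1 = (s * u + x₀) * q' ∧ p' = (s * v + y₀) * q' →
      1 = (t * u + x₀) * q'' ∧ p'' = (t * v + y₀) * q'' →
      (p - p') * (q - q'') - (p - p'') * (q - q') = 0 := by
    rintro p q p' q' p'' q'' ⟨h1, rfl⟩ ⟨h2, rfl⟩ ⟨h3, rfl⟩
    linear_combination ((s * v + y₀) * q' * q'' - (t * v + y₀) * q'' * q') * h1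
      + ((t * v + y₀) * q'' * q - (r * v + y₀) * q * q'') * h2
      + ((r * v + y₀) * q * q' - (s * v + y₀) * q' * q) * h3
  have hzero := hdet _ _ _ _ _ _ hr hs ht
  rw [sin_mul_cos_sub_sin_mul_cos, sin_mul_cos_sub_sin_mul_cos, add_sub_add_left_eq_sub,
    add_sub_add_left_eq_sub, cos_sq_sub_cos_sq, cos_sq_sub_cos_sq] at hzero
  have hβγ' : sin (β - γ) = sin (α + β) * cos (α + γ) - cos (α + β) * sin (α + γ) := by
    rw [← sin_sub, add_sub_add_left_eq_sub]
  apply mul_ne_zero (mul_ne_zero hαβ hαγ) hβγ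
  rw [hβγ']
  linear_combination hzero

open Real in
theorem sin_mul_pi_div_ne_zero {n : ℕ} {k : ℤ} (hn : 0 < n) (hk : ¬ (n : ℤ) ∣ k) :
    sin (k * π / n) ≠ 0 := by
  intro h
  obtain ⟨m, hm⟩ := sin_eq_zero_iff.1 h
  have hn' : (n : ℝ) ≠ 0 := by positivity
  rw [eq_div_iff hn'] at hm
  have h1 : (k : ℝ) = n * m := mul_right_cancel₀ pi_ne_zero (by linarith)
  exact hk ⟨m, by exact_mod_cast h1⟩

open Real in
/-- Parameters of `n` points on the conic whose pairwise sums avoid the multiples of `π`. -/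
noncomputable def conicParam (n k : ℕ) : ℝ := (4 * k + 1) * π / (4 * n)

open Real in
/-- Parameters of the `n` points of the axis blocking the conic points. -/
noncomputable def axisParam (n k : ℕ) : ℝ := (2 * k + 1) * π / (2 * n)

open Real in
theorem sin_axisParam_ne_zero {n : ℕ} (hn : 0 < n) (k : ℕ) : sin (axisParam n k) ≠ 0 := by
  have h := sin_mul_pi_div_ne_zero (n := 2 * n) (k := 2 * k + 1) (by omega) (by
    rintro ⟨c, hc⟩
    push_cast at hc
    rw [mul_assoc] at hc
    omega)
  push_cast at h
  exact h

theorem not_dvd_sub_of_lt {n j k : ℕ} (hj : j < n) (hk : k < n) (hjk : j ≠ k) :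
    ¬ (n : ℤ) ∣ (j : ℤ) - k := by
  intro h
  have := Int.eq_zero_of_abs_lt_dvd h (by rw [abs_lt]; omega)
  omega

open Real in
theorem sin_conicParam_sub_ne_zero {n j k : ℕ} (hj : j < n) (hk : k < n) (hjk : j ≠ k) :
    sin (conicParam n j - conicParam n k) ≠ 0 := by
  have h := sin_mul_pi_div_ne_zero (by omega) (not_dvd_sub_of_lt hj hk hjk)
  have hn : (n : ℝ) ≠ 0 := Nat.cast_ne_zero.mpr (by omega)
  convert h using 2
  simp only [conicParam]
  push_cast
  field_simp
  ring

open Real in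
theorem sin_axisParam_sub_ne_zero {n j k : ℕ} (hj : j < n) (hk : k < n) (hjk : j ≠ k) :
    sin (axisParam n j - axisParam n k) ≠ 0 := by
  have h := sin_mul_pi_div_ne_zero (by omega) (not_dvd_sub_of_lt hj hk hjk)
  have hn : (n : ℝ) ≠ 0 := Nat.cast_ne_zero.mpr (by omega)
  convert h using 2
  simp only [axisParam]
  push_cast
  field_simp
  ring

theorem conicParam_add (n j k : ℕ) :
    conicParam n j + conicParam n k = axisParam n (j + k) := by
  rcases Nat.eq_zero_or_pos n with rfl | hn
  · simp [conicParam, axisParam]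
  simp only [conicParam, axisParam]
  push_cast
  field_simp
  ring

theorem axisPoint_axisParam_add {n : ℕ} (hn : 0 < n) (k : ℕ) :
    axisPoint (axisParam n (k + n)) = axisPoint (axisParam n k) := by
  rw [← axisPoint_add_pi (axisParam n k)]
  congr 1
  simp only [axisParam]
  push_cast
  field_simp
  ring

/-- For every `n ≥ 3` there are `n` points in general position blocked by `n` points. -/
theorem exists_n_points_blocked_by_n (n : ℕ) (hn : 3 ≤ n) :
    ∃ P B : Finset (ℝ × ℝ), P.card = n ∧ B.card = n ∧ B ∩ P = ∅ ∧
      GenPos P ∧ Blocks B P := by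
  classical
  have hpos : 0 < n := by omega
  have hadd (j k : ℕ) : Real.sin (conicParam n j + conicParam n k) ≠ 0 := by
    rw [conicParam_add]
    exact sin_axisParam_ne_zero hpos _
  refine ⟨(Finset.range n).image fun k ↦ conicPoint (conicParam n k),
    (Finset.range n).image fun k ↦ axisPoint (axisParam n k), ?_, ?_, ?_, ?_, ?_⟩
  · rw [Finset.card_image_of_injOn, Finset.card_range]
    intro j hj k hk h
    by_contra hjk
    exact conicPoint_ne (hadd j k)
      (sin_conicParam_sub_ne_zero (by simpa using hj) (by simpa using hk) hjk) h
  · rw [Finset.card_image_of_injOn, Finset.card_range]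
    intro j hj k hk h
    by_contra hjk
    exact axisPoint_ne (sin_axisParam_ne_zero hpos j) (sin_axisParam_ne_zero hpos k)
      (sin_axisParam_sub_ne_zero (by simpa using hj) (by simpa using hk) hjk) h
  · rw [← Finset.disjoint_iff_inter_eq_empty, Finset.disjoint_left]
    intro b hb hp
    obtain ⟨j, -, rfl⟩ := Finset.mem_image.1 hb
    obtain ⟨k, -, hk⟩ := Finset.mem_image.1 hp
    exact axisPoint_ne_conicPoint _ _ hk.symm
  · intro p hp q hq r hr hpq hpr hqr
    obtain ⟨i, hi, rfl⟩ := Finset.mem_image.1 hp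
    obtain ⟨j, hj, rfl⟩ := Finset.mem_image.1 hq
    obtain ⟨k, hk, rfl⟩ := Finset.mem_image.1 hr
    rw [Finset.mem_range] at hi hj hk
    exact not_collinear_conicPoint
      (sin_conicParam_sub_ne_zero hi hj (by rintro rfl; exact hpq rfl))
      (sin_conicParam_sub_ne_zero hi hk (by rintro rfl; exact hpr rfl))
      (sin_conicParam_sub_ne_zero hj hk (by rintro rfl; exact hqr rfl))
  · intro p hp q hq hpq
    obtain ⟨j, hj, rfl⟩ := Finset.mem_image.1 hp
    obtain ⟨k, hk, rfl⟩ := Finset.mem_image.1 hq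
    rw [Finset.mem_range] at hj hk
    have hmem := axisPoint_mem_secant (hadd j k)
      (sin_conicParam_sub_ne_zero hj hk (by rintro rfl; exact hpq rfl))
    rw [conicParam_add] at hmem
    refine ⟨_, ?_, hmem⟩
    rcases lt_or_ge (j + k) n with h | h
    · exact Finset.mem_image_of_mem _ (Finset.mem_range.2 h)
    · rw [← Nat.sub_add_cancel h, axisPoint_axisParam_add hpos]
      exact Finset.mem_image.2 ⟨j + k - n, Finset.mem_range.2 (by omega), rfl⟩
end

section
/- Let n ≥ 4 and let ℒ and ℬ be disjoint finite sets of 2-dimensional linear subspaces of ℝ³ with |ℒ| = n and |ℬ| = n − 1, such that: (a) for any three distinct members l₁, l₂, l₃ of ℒ, the intersection l₁ ∩ l₂ ∩ l₃ is the zero subspace; and (b) for every pair of distinct members l₁, l₂ of ℒ there is exactly one b ∈ ℬ with l₁ ∩ l₂ ⊆ b. Then n = 4. -/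
/-- A finite family of linear functionals on a real vector space, each pair of which is blocked by
a functional of a second family: `B (r i j)` is a combination of `L i` and `L j` with nonzero
coefficients, and `P i j` is a point at which, among the `L k`, only `L i` and `L j` vanish. -/
structure BlockedFunctionals (V ι κ : Type*) [AddCommGroup V] [Module ℝ V] where
  L : ι → Module.Dual ℝ V
  B : κ → Module.Dual ℝ V
  r : ι → ι → κ
  a : ι → ι → ℝ
  b : ι → ι → ℝ
  P : ι → ι → V
  r_comm : ∀ i j, i ≠ j → r i j = r j i
  b_ne : ∀ i j, i ≠ j → b i j ≠ 0
  B_apply : ∀ i j, i ≠ j → ∀ v, B (r i j) v = a i j * L i v + b i j * L j v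
  P_left : ∀ i j, i ≠ j → L i (P i j) = 0
  P_right : ∀ i j, i ≠ j → L j (P i j) = 0
  P_ne : ∀ i j k, i ≠ j → k ≠ i → k ≠ j → L k (P i j) ≠ 0
  B_sep : ∀ s t, s ≠ t → ∃ v, B s v = 0 ∧ B t v ≠ 0

section Polynomial

open Finset Module Polynomial

variable {V : Type*} [AddCommGroup V] [Module ℝ V]

/-- The restriction of `G` to each affine line is a polynomial of degree at most `d`. -/
def IsPolynomialOnLines (d : ℕ) (G : V → ℝ) : Prop :=
  ∀ u v : V, ∃ p : ℝ[X], p.natDegree ≤ d ∧ ∀ t : ℝ, p.eval t = G (u + t • v)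

theorem isPolynomialOnLines_prod {ι : Type*} (s : Finset ι) (f : ι → Dual ℝ V) :
    IsPolynomialOnLines #s (fun v ↦ ∏ i ∈ s, f i v) := by
  intro u v
  refine ⟨∏ i ∈ s, (C (f i v) * X + C (f i u)), ?_, fun t ↦ ?_⟩
  · refine (natDegree_prod_le _ _).trans ?_
    refine (sum_le_card_nsmul s _ 1 fun i _ ↦ natDegree_linear_le).trans ?_
    simp
  · rw [eval_prod]
    refine prod_congr rfl fun i _ ↦ ?_
    simp
    ring

theorem IsPolynomialOnLines.sum {ι : Type*} {d : ℕ} (s : Finset ι) {G : ι → V → ℝ}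
    (h : ∀ i ∈ s, IsPolynomialOnLines d (G i)) :
    IsPolynomialOnLines d (fun v ↦ ∑ i ∈ s, G i v) := by
  intro u v
  have h' : ∀ i, ∃ p : ℝ[X], i ∈ s → p.natDegree ≤ d ∧ ∀ t : ℝ, p.eval t = G i (u + t • v) := by
    intro i
    by_cases hi : i ∈ s
    · obtain ⟨p, hp⟩ := h i hi u v
      exact ⟨p, fun _ ↦ hp⟩
    · exact ⟨0, fun h ↦ absurd h hi⟩
  choose p hp using h'
  refine ⟨∑ i ∈ s, p i, natDegree_sum_le_of_forall_le _ _ fun i hi ↦ (hp i hi).1, fun t ↦ ?_⟩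
  rw [eval_finsetSum]
  exact sum_congr rfl fun i hi ↦ (hp i hi).2 t

theorem IsPolynomialOnLines.const_mul {d : ℕ} {G : V → ℝ} (c : ℝ)
    (h : IsPolynomialOnLines d G) : IsPolynomialOnLines d (fun v ↦ c * G v) := by
  intro u v
  obtain ⟨p, hp, hpe⟩ := h u v
  exact ⟨C c * p, (natDegree_C_mul_le _ _).trans hp, fun t ↦ by simp [hpe]⟩

theorem IsPolynomialOnLines.sub {d : ℕ} {G H : V → ℝ} (hG : IsPolynomialOnLines d G)
    (hH : IsPolynomialOnLines d H) : IsPolynomialOnLines d (fun v ↦ G v - H v) := by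
  intro u v
  obtain ⟨p, hp, hpe⟩ := hG u v
  obtain ⟨q, hq, hqe⟩ := hH u v
  exact ⟨p - q, (natDegree_sub_le _ _).trans (max_le hp hq), fun t ↦ by simp [hpe, hqe]⟩

/-- A polynomial function vanishing on more hyperplanes than its degree is zero. -/
theorem IsPolynomialOnLines.eq_zero {κ : Type*} [Fintype κ] {d : ℕ} {G : V → ℝ}
    (hG : IsPolynomialOnLines d G) (B : κ → Dual ℝ V)
    (hB : ∀ s t, s ≠ t → ∃ v, B s v = 0 ∧ B t v ≠ 0) (hB₀ : ∀ s, ∃ v, B s v ≠ 0)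
    (hd : d < Fintype.card κ) (hz : ∀ s v, B s v = 0 → G v = 0) (u : V) : G u = 0 := by
  by_cases hu : ∃ s, B s u = 0
  · obtain ⟨s, hs⟩ := hu
    exact hz s u hs
  push Not at hu
  obtain ⟨v, hv⟩ := Dual.exists_forall_ne_zero_of_forall_exists
    (Sum.elim B fun p : {p : κ × κ // p.1 ≠ p.2} ↦ B p.1.1 u • B p.1.2 - B p.1.2 u • B p.1.1) (by
      rintro (s | ⟨⟨s, t⟩, hst⟩)
      · exact hB₀ s
      · obtain ⟨w, hs, ht⟩ := hB s t hst
        exact ⟨w, by simp [hs, ht, hu]⟩)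
  have hv₀ (s : κ) : B s v ≠ 0 := hv (.inl s)
  obtain ⟨p, hp, hpe⟩ := hG u v
  have hinj : Function.Injective fun s ↦ -(B s u / B s v) := by
    intro s t hst
    by_contra hne
    apply hv (.inr ⟨(s, t), hne⟩)
    have := neg_injective hst
    rw [div_eq_div_iff (hv₀ s) (hv₀ t)] at this
    simp
    linarith
  have hp₀ : p = 0 := by
    refine eq_zero_of_natDegree_lt_card_of_eval_eq_zero p hinj (fun s ↦ ?_) (hp.trans_lt hd)
    rw [hpe]
    apply hz s
    have := hv₀ s
    simp
    field_simp
    ring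
  simpa [hp₀] using (hpe 0).symm

/-- Differentiating a vanishing weighted power sum of functionals in a direction `w`. -/
theorem sum_mul_mul_pow_eq_zero {ι : Type*} [Fintype ι] (f : ι → Dual ℝ V) (c : ι → ℝ) (m : ℕ)
    (h : ∀ u, ∑ i, c i * f i u ^ (m + 1) = 0) (w u : V) :
    ∑ i, c i * f i w * f i u ^ m = 0 := by
  have h₁ : HasDerivAt (fun t : ℝ ↦ ∑ i, c i * f i (u + t • w) ^ (m + 1))
      (∑ i, c i * ((m + 1) * f i u ^ m * f i w)) 0 := by
    refine HasDerivAt.fun_sum fun i _ ↦ HasDerivAt.const_mul _ ?_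
    have h₂ : HasDerivAt (fun t : ℝ ↦ f i (u + t • w)) (f i w) 0 := by
      simpa using ((hasDerivAt_id (0 : ℝ)).mul_const (f i w)).const_add (f i u)
    simpa using h₂.fun_pow (m + 1)
  simp only [h] at h₁
  have h₃ := h₁.unique (hasDerivAt_const (0 : ℝ) (0 : ℝ))
  have h₄ : (m + 1 : ℝ) * ∑ i, c i * f i w * f i u ^ m = 0 := by
    rw [← h₃, mul_sum]
    exact sum_congr rfl fun i _ ↦ by ring
  exact (mul_eq_zero.mp h₄).resolve_left (by positivity)

/-- Polarization of a vanishing power sum of functionals. -/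
theorem sum_prod_mul_pow_eq_zero {ι τ : Type*} [Fintype ι] (f : ι → Dual ℝ V) (d : ℕ)
    (h : ∀ u, ∑ i, f i u ^ d = 0) (q : τ → V) (T : Finset τ) (hT : #T ≤ d) (u : V) :
    ∑ i, (∏ s ∈ T, f i (q s)) * f i u ^ (d - #T) = 0 := by
  classical
  induction T using Finset.induction_on generalizing u with
  | empty => simpa using h u
  | insert x T hx ih =>
    rw [card_insert_of_notMem hx] at hT ⊢
    have hm : d - #T = d - (#T + 1) + 1 := by omega
    have ih' := ih (by omega)
    rw [hm] at ih'
    rw [← sum_mul_mul_pow_eq_zero f _ _ ih' (q x) u]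
    exact sum_congr rfl fun i _ ↦ by rw [prod_insert hx, mul_comm (f i (q x))]

end Polynomial

namespace BlockedFunctionals

open Finset Module

variable {V ι κ : Type*} [AddCommGroup V] [Module ℝ V] [Fintype ι] [DecidableEq ι] [Fintype κ]
  (D : BlockedFunctionals V ι κ)

omit [Fintype ι] [DecidableEq ι] [Fintype κ] in
theorem r_injOn {i j k : ι} (hj : i ≠ j) (hk : i ≠ k) (h : D.r i j = D.r i k) : j = k := by
  by_contra hjk
  have h₁ := D.B_apply i j hj (D.P i j)
  rw [h, D.B_apply i k hk, D.P_left i j hj, D.P_right i j hj] at h₁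
  simp [D.b_ne i k hk, D.P_ne i j k hj hk.symm (Ne.symm hjk)] at h₁

theorem image_r [DecidableEq κ] (hcard : Fintype.card κ + 1 = Fintype.card ι) (i : ι) :
    (univ.erase i).image (D.r i) = univ := by
  apply eq_univ_of_card
  rw [card_image_of_injOn, card_erase_of_mem (mem_univ _), card_univ]
  · omega
  · intro j hj k hk h
    simp only [coe_erase, coe_univ, Set.mem_sdiff, Set.mem_singleton_iff] at hj hk
    exact D.r_injOn (Ne.symm hj.2) (Ne.symm hk.2) h

theorem exists_r_eq (hcard : Fintype.card κ + 1 = Fintype.card ι) (s : κ) (i : ι) :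
    ∃ j, j ≠ i ∧ D.r i j = s := by
  classical
  have : s ∈ (univ.erase i).image (D.r i) := by simp [D.image_r hcard]
  simpa using this

/-- Each `B s` matches the indices of the `L i` in pairs. -/
theorem exists_involutive (hcard : Fintype.card κ + 1 = Fintype.card ι) (s : κ) :
    ∃ σ : ι → ι, (∀ i, σ i ≠ i) ∧ (∀ i, D.r i (σ i) = s) ∧ Function.Involutive σ := by
  choose σ hσ hr using D.exists_r_eq hcard s
  refine ⟨σ, hσ, hr, fun i ↦ D.r_injOn (hσ (σ i)).symm (hσ i) ?_⟩
  rw [hr, D.r_comm _ _ (hσ i), hr]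

/-- The weight of `L i` in the partial fraction expansion of `∏ B / ∏ L`. -/
def weight (i : ι) : ℝ := ∏ j ∈ univ.erase i, D.b i j

omit [Fintype κ] in
theorem weight_ne_zero (i : ι) : D.weight i ≠ 0 :=
  prod_ne_zero_iff.mpr fun j hj ↦ D.b_ne i j (ne_of_mem_erase hj).symm

theorem prod_B_of_L_eq_zero (hcard : Fintype.card κ + 1 = Fintype.card ι) (i : ι) (v : V)
    (hv : D.L i v = 0) : ∏ s, D.B s v = D.weight i * ∏ j ∈ univ.erase i, D.L j v := by
  classical
  rw [← D.image_r hcard i, prod_image, weight, ← prod_mul_distrib]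
  · refine prod_congr rfl fun j hj ↦ ?_
    rw [D.B_apply i j (ne_of_mem_erase hj).symm, hv]
    ring
  · intro j hj k hk h
    simp only [coe_erase, coe_univ, Set.mem_sdiff, Set.mem_singleton_iff] at hj hk
    exact D.r_injOn (Ne.symm hj.2) (Ne.symm hk.2) h

theorem prod_B_eq (hcard : Fintype.card κ + 1 = Fintype.card ι) (hι : 3 ≤ Fintype.card ι)
    (v : V) : ∏ s, D.B s v = ∑ i, D.weight i * ∏ j ∈ univ.erase i, D.L j v := by
  have hthird (i j : ι) : ∃ k, k ≠ i ∧ k ≠ j := by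
    obtain ⟨k, hk⟩ := exists_mem_notMem_of_card_lt_card (s := {i, j}) (t := univ)
      (card_le_two.trans_lt (by rw [card_univ]; omega))
    exact ⟨k, by simpa using hk⟩
  have hsep : ∀ i j, i ≠ j → ∃ v, D.L i v = 0 ∧ D.L j v ≠ 0 := by
    intro i j hij
    obtain ⟨k, hki, hkj⟩ := hthird i j
    exact ⟨D.P i k, D.P_left i k hki.symm, D.P_ne i k j hki.symm hij.symm hkj.symm⟩
  rw [← sub_eq_zero]
  refine IsPolynomialOnLines.eq_zero (d := Fintype.card κ)
    (G := fun v ↦ ∏ s, D.B s v - ∑ i, D.weight i * ∏ j ∈ univ.erase i, D.L j v)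
    (.sub (isPolynomialOnLines_prod univ D.B) (.sum _ fun i _ ↦ .const_mul _ ?_)) D.L hsep
    (fun i ↦ ?_) (by omega) (fun i v hv ↦ ?_) v
  · have := isPolynomialOnLines_prod (univ.erase i) D.L
    rwa [card_erase_of_mem (mem_univ _), card_univ, ← hcard, Nat.add_sub_cancel] at this
  · obtain ⟨k, hk, -⟩ := hthird i i
    obtain ⟨v, -, hv⟩ := hsep k i hk
    exact ⟨v, hv⟩
  · rw [D.prod_B_of_L_eq_zero hcard i v hv, sub_eq_zero, eq_comm]
    refine sum_eq_single i (fun k _ hk ↦ ?_) (by simp)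
    rw [prod_eq_zero (mem_erase.mpr ⟨hk.symm, mem_univ i⟩) hv, mul_zero]

/-- The functionals rescaled so that `B (r i j)` is proportional to the sum of the `i`th and
the `j`th. -/
noncomputable def scaled (i : ι) : Dual ℝ V := (D.weight i)⁻¹ • D.L i

theorem scaled_add_eq_zero (hcard : Fintype.card κ + 1 = Fintype.card ι)
    (hι : 3 ≤ Fintype.card ι) {i j : ι} (hij : i ≠ j) {w : V} (hw : D.B (D.r i j) w = 0) :
    D.scaled i w + D.scaled j w = 0 := by
  set S := (univ.erase i).erase j with hS
  set p := D.P i j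
  have hj : j ∈ univ.erase i := by simp [hij.symm]
  have hi : i ∈ univ.erase j := by simp [hij]
  have hS' : (univ.erase j).erase i = S := erase_right_comm
  set f : ℝ → ℝ := fun t ↦ (D.weight i * D.L j w + D.weight j * D.L i w) *
      ∏ k ∈ S, (D.L k p + t * D.L k w) + t * (D.L i w * D.L j w *
      ∑ k ∈ S, D.weight k * ∏ l ∈ S.erase k, (D.L l p + t * D.L l w)) with hf
  have hpi : D.L i p = 0 := D.P_left i j hij
  have hpj : D.L j p = 0 := D.P_right i j hij
  have hmul (t : ℝ) : t * f t = 0 := by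
    have h₁ := D.prod_B_eq hcard hι (p + t • w)
    have h₂ : D.B (D.r i j) (p + t • w) = 0 := by
      simp [hw, D.B_apply i j hij p, hpi, hpj]
    rw [prod_eq_zero (f := fun s ↦ D.B s (p + t • w)) (mem_univ _) h₂, ← add_sum_erase _ _ (mem_univ i),
      ← add_sum_erase _ _ hj, ← hS, ← mul_prod_erase _ _ hj, ← mul_prod_erase _ _ hi, hS',
      ← hS] at h₁
    have h₃ : ∀ k ∈ S, D.weight k * ∏ l ∈ univ.erase k, D.L l (p + t • w) =
        t ^ 2 * (D.L i w * D.L j w) *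
          (D.weight k * ∏ l ∈ S.erase k, (D.L l p + t * D.L l w)) := by
      intro k hk
      have hki : i ≠ k := by rintro rfl; simp [hS] at hk
      have hkj : j ≠ k := by rintro rfl; simp [hS] at hk
      have hi' : i ∈ univ.erase k := by simp [hki]
      have hj' : j ∈ (univ.erase k).erase i := by simp [hkj, hij.symm]
      have hS'' : ((univ.erase k).erase i).erase j = S.erase k := by
        ext l
        simp [hS]
        tauto
      rw [← mul_prod_erase _ _ hi', ← mul_prod_erase _ _ hj', hS'']
      simp [hpi, hpj]
      ring
    rw [sum_congr rfl h₃, ← mul_sum] at h₁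
    simp only [map_add, map_smul, smul_eq_mul, hpi, hpj, zero_add] at h₁
    rw [h₁, hf]
    ring
  have hcont : Continuous f := by fun_prop
  have hf₀ : f = fun _ ↦ 0 := by
    refine hcont.ext_on (dense_compl_singleton (0 : ℝ)) continuous_const fun t ht ↦ ?_
    exact (mul_eq_zero.mp (hmul t)).resolve_left ht
  have h₀ := congrFun hf₀ 0
  simp only [hf, zero_mul, add_zero, mul_eq_zero] at h₀
  have hprod : ∏ k ∈ S, D.L k p ≠ 0 := by
    refine prod_ne_zero_iff.mpr fun k hk ↦ D.P_ne i j k hij ?_ ?_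
    · rintro rfl; simp [hS] at hk
    · rintro rfl; simp [hS] at hk
  have h₁ := h₀.resolve_right hprod
  have hci := D.weight_ne_zero i
  have hcj := D.weight_ne_zero j
  simp only [scaled, LinearMap.smul_apply, smul_eq_mul]
  field_simp
  linarith

theorem sum_scaled_pow_eq_zero (hcard : Fintype.card κ + 1 = Fintype.card ι)
    (hι : 3 ≤ Fintype.card ι) {d : ℕ} (hd : Odd d) (hdκ : d < Fintype.card κ) (u : V) :
    ∑ i, D.scaled i u ^ d = 0 := by
  refine IsPolynomialOnLines.eq_zero (d := d) (G := fun u ↦ ∑ i, D.scaled i u ^ d)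
    (.sum _ fun i _ ↦ ?_) D.B D.B_sep (fun s ↦ ?_) hdκ (fun s v hv ↦ ?_) u
  · simpa using isPolynomialOnLines_prod (range d) fun _ ↦ D.scaled i
  · obtain ⟨t, ht⟩ := Fintype.exists_ne_of_one_lt_card (by omega) s
    obtain ⟨v, -, hv⟩ := D.B_sep t s ht
    exact ⟨v, hv⟩
  · obtain ⟨σ, hσ, hr, hσσ⟩ := D.exists_involutive hcard s
    refine sum_involution (fun i _ ↦ σ i) (fun i _ ↦ ?_) (fun i _ _ ↦ hσ i)
      (fun i _ ↦ mem_univ _) (fun i _ ↦ hσσ i)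
    have h := D.scaled_add_eq_zero hcard hι (hσ i).symm (w := v) (by rw [hr, hv])
    rw [eq_neg_of_add_eq_zero_right h, hd.neg_pow]
    ring

include D in
theorem even_card (hcard : Fintype.card κ + 1 = Fintype.card ι) [Nonempty κ] :
    Even (Fintype.card ι) := by
  obtain ⟨s⟩ := ‹Nonempty κ›
  obtain ⟨σ, hσ, -, hσσ⟩ := D.exists_involutive hcard s
  have h : ∑ i : ι, (1 : ZMod 2) = 0 :=
    sum_involution (fun i _ ↦ σ i) (fun i _ ↦ by decide) (fun i _ _ ↦ hσ i)
      (fun i _ ↦ mem_univ _) (fun i _ ↦ hσσ i)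
  rw [sum_const, card_univ, nsmul_one] at h
  exact (ZMod.natCast_eq_zero_iff_even).mp h

include D in
theorem card_le_four (hcard : Fintype.card κ + 1 = Fintype.card ι) : Fintype.card ι ≤ 4 := by
  by_contra! hlt
  have : Nonempty κ := Fintype.card_pos_iff.mp (by omega)
  obtain ⟨m, hm⟩ := D.even_card hcard
  obtain ⟨x, y, z, hxy, hxz, hyz⟩ := Fintype.two_lt_card_iff.mp (show 2 < Fintype.card ι by omega)
  set S := ((univ.erase x).erase y).erase z with hS
  have hScard : #S = Fintype.card ι - 3 := by
    rw [hS, card_erase_of_mem (by simp [hxz.symm, hyz.symm]),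
      card_erase_of_mem (by simp [hxy.symm]), card_erase_of_mem (mem_univ _), card_univ]
    omega
  have hmem {k : ι} : k ∈ S ↔ k ≠ z ∧ k ≠ y ∧ k ≠ x := by simp [hS]
  obtain ⟨e, he, e', he', hee⟩ := one_lt_card.mp (show 1 < #S by omega)
  have hpow := D.sum_scaled_pow_eq_zero hcard (by omega) (d := #S) ⟨m - 2, by omega⟩ (by omega)
  have hsum := sum_prod_mul_pow_eq_zero D.scaled _ hpow
    (fun s ↦ if s = e then D.P s y else D.P s z) S le_rfl 0
  simp only [Nat.sub_self, pow_zero, mul_one] at hsum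
  rw [sum_eq_single x] at hsum
  · refine prod_ne_zero_iff.mpr (fun s hs ↦ ?_) hsum
    obtain ⟨hsz, hsy, hsx⟩ := hmem.mp hs
    have hx := D.weight_ne_zero x
    split_ifs
    · simp [scaled, hx, D.P_ne s y x hsy hsx.symm hxy]
    · simp [scaled, hx, D.P_ne s z x hsz hsx.symm hxz]
  · intro k _ hkx
    by_cases hky : k = y
    · refine prod_eq_zero he ?_
      simp [scaled, hky, D.P_right e y (hmem.mp he).2.1]
    by_cases hkz : k = z
    · refine prod_eq_zero he' ?_
      simp [scaled, hkz, hee.symm, D.P_right e' z (hmem.mp he').1]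
    · refine prod_eq_zero (hmem.mpr ⟨hkz, hky, hkx⟩) ?_
      split_ifs
      · simp [scaled, D.P_left k y hky]
      · simp [scaled, D.P_left k z hkz]
  · simp

end BlockedFunctionals

section Planes

open Module

variable {V : Type*} [AddCommGroup V] [Module ℝ V]

theorem exists_ker_eq_of_finrank_add_one_eq [FiniteDimensional ℝ V] {W : Submodule ℝ V}
    (hW : finrank ℝ W + 1 = finrank ℝ V) : ∃ f : Dual ℝ V, LinearMap.ker f = W := by
  have hlt : W < ⊤ := lt_top_iff_ne_top.mpr fun h ↦ by
    rw [h, finrank_top] at hW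
    omega
  obtain ⟨f, hf, hle⟩ := W.exists_le_ker_of_lt_top hlt
  refine ⟨f, (Submodule.eq_of_le_of_finrank_eq hle ?_).symm⟩
  have := Dual.finrank_ker_add_one_of_ne_zero hf
  omega

theorem exists_eq_add_of_ker_inf_ker_le {f g h : Dual ℝ V}
    (hle : LinearMap.ker f ⊓ LinearMap.ker g ≤ LinearMap.ker h) :
    ∃ a b : ℝ, ∀ v, h v = a * f v + b * g v := by
  have hmem : h ∈ Submodule.span ℝ (Set.range ![f, g]) := by
    apply mem_span_of_iInf_ker_le_ker
    refine le_trans (fun v hv ↦ ?_) hle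
    simp only [Submodule.mem_iInf] at hv
    exact ⟨hv 0, hv 1⟩
  rw [Matrix.range_cons, Matrix.range_cons, Matrix.range_empty, Set.union_empty,
    Set.singleton_union, Submodule.mem_span_pair] at hmem
  obtain ⟨a, b, rfl⟩ := hmem
  exact ⟨a, b, fun v ↦ by simp⟩

end Planes


/-- The dual statement of the blocking theorem, in the projective plane.  Lines of
`ℙ²(ℝ)` are identified with 2-dimensional linear subspaces of `ℝ³`.  If `ℒ` and `ℬ`
are disjoint finite sets of such planes with `|ℒ| = n ≥ 4` and `|ℬ| = n - 1` such that
no three members of `ℒ` are concurrent (any three meet only at `0`) and every pair of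
distinct members of `ℒ` has a unique member of `ℬ` through its intersection point,
then `n = 4`. -/
theorem dual_blocking_configuration_eq_four (n : ℕ) (hn : 4 ≤ n)
    (L B : Finset (Submodule ℝ (Fin 3 → ℝ)))
    (hdim : ∀ l : Submodule ℝ (Fin 3 → ℝ), (l ∈ L ∨ l ∈ B) → Module.finrank ℝ l = 2)
    (hdisj : Disjoint L B) (hLcard : L.card = n) (hBcard : B.card = n - 1)
    (hconc : ∀ l₁ ∈ L, ∀ l₂ ∈ L, ∀ l₃ ∈ L, l₁ ≠ l₂ → l₁ ≠ l₃ → l₂ ≠ l₃ →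
      l₁ ⊓ l₂ ⊓ l₃ = ⊥)
    (hblock : ∀ l₁ ∈ L, ∀ l₂ ∈ L, l₁ ≠ l₂ → ∃! b, b ∈ B ∧ l₁ ⊓ l₂ ≤ b) :
    n = 4 := by
  classical
  have hfun : ∀ W : {W : Submodule ℝ (Fin 3 → ℝ) // W ∈ L ∨ W ∈ B},
      ∃ f : Module.Dual ℝ (Fin 3 → ℝ), LinearMap.ker f = W.1 := fun W ↦
    exists_ker_eq_of_finrank_add_one_eq (by rw [hdim W.1 W.2]; simp)
  choose F hF using hfun
  set f : L → Module.Dual ℝ (Fin 3 → ℝ) := fun l ↦ F ⟨l, .inl l.2⟩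
  set g : B → Module.Dual ℝ (Fin 3 → ℝ) := fun b ↦ F ⟨b, .inr b.2⟩
  have hf (l : L) : LinearMap.ker (f l) = l := hF _
  have hg (b : B) : LinearMap.ker (g b) = b := hF _
  have hbl : ∀ l₁ l₂ : L, ∃ b : B, l₁ ≠ l₂ → (l₁ ⊓ l₂ : Submodule ℝ (Fin 3 → ℝ)) ≤ b ∧
      ∀ b' : B, (l₁ ⊓ l₂ : Submodule ℝ (Fin 3 → ℝ)) ≤ b' → b' = b := by
    intro l₁ l₂
    by_cases h : l₁ = l₂
    · obtain ⟨b, hb⟩ := Finset.card_pos.mp (show 0 < B.card by omega)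
      exact ⟨⟨b, hb⟩, fun h' ↦ absurd h h'⟩
    · obtain ⟨b, ⟨hb, hle⟩, huniq⟩ := hblock l₁ l₁.2 l₂ l₂.2 (Subtype.coe_ne_coe.mpr h)
      exact ⟨⟨b, hb⟩, fun _ ↦ ⟨hle, fun b' hb' ↦ Subtype.ext (huniq b' ⟨b'.2, hb'⟩)⟩⟩
  choose r hr using hbl
  have hcoef : ∀ l₁ l₂ : L, ∃ a b : ℝ, l₁ ≠ l₂ →
      ∀ v, g (r l₁ l₂) v = a * f l₁ v + b * f l₂ v := by
    intro l₁ l₂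
    by_cases h : l₁ = l₂
    · exact ⟨0, 0, fun h' ↦ absurd h h'⟩
    · obtain ⟨a, b, hab⟩ := exists_eq_add_of_ker_inf_ker_le (f := f l₁) (g := f l₂)
        (h := g (r l₁ l₂)) (by rw [hf, hf, hg]; exact (hr l₁ l₂ h).1)
      exact ⟨a, b, fun _ ↦ hab⟩
  choose a b hab using hcoef
  have hpt : ∀ l₁ l₂ : L, ∃ p : Fin 3 → ℝ, p ∈ (l₁ : Submodule ℝ (Fin 3 → ℝ)) ∧
      p ∈ (l₂ : Submodule ℝ (Fin 3 → ℝ)) ∧ p ≠ 0 := by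
    intro l₁ l₂
    have hne : (l₁ ⊓ l₂ : Submodule ℝ (Fin 3 → ℝ)) ≠ ⊥ := fun hbot ↦ by
      have h₁ := Submodule.finrank_sup_add_finrank_inf_eq (l₁ : Submodule ℝ (Fin 3 → ℝ)) l₂
      have h₂ := Submodule.finrank_le (l₁ ⊔ l₂ : Submodule ℝ (Fin 3 → ℝ))
      rw [hbot, hdim _ (.inl l₁.2), hdim _ (.inl l₂.2), finrank_bot] at h₁
      simp at h₂
      omega
    obtain ⟨p, hp, hp₀⟩ := Submodule.exists_mem_ne_zero_of_ne_bot hne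
    exact ⟨p, hp.1, hp.2, hp₀⟩
  choose P hP₁ hP₂ hP₀ using hpt
  have hfz (l : L) (v : Fin 3 → ℝ) : f l v = 0 ↔ v ∈ (l : Submodule ℝ (Fin 3 → ℝ)) := by
    rw [← hf l, LinearMap.mem_ker]
  have hgz (s : B) (v : Fin 3 → ℝ) : g s v = 0 ↔ v ∈ (s : Submodule ℝ (Fin 3 → ℝ)) := by
    rw [← hg s, LinearMap.mem_ker]
  let D : BlockedFunctionals (Fin 3 → ℝ) L B :=
    { L := f
      B := g
      r := r
      a := a
      b := b
      P := P
      r_comm := fun i j hij ↦ (hr j i hij.symm).2 _ (by rw [inf_comm]; exact (hr i j hij).1)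
      b_ne := fun i j hij hb ↦ by
        have hle : (i : Submodule ℝ (Fin 3 → ℝ)) ≤ r i j := fun v hv ↦ by
          rw [← hgz, hab i j hij, (hfz i v).mpr hv, hb]
          simp
        have heq := Submodule.eq_of_le_of_finrank_eq hle
          (by rw [hdim _ (.inl i.2), hdim _ (.inr (r i j).2)])
        exact Finset.disjoint_left.mp hdisj i.2 (heq ▸ (r i j).2)
      B_apply := hab
      P_left := fun i j _ ↦ (hfz _ _).mpr (hP₁ i j)
      P_right := fun i j _ ↦ (hfz _ _).mpr (hP₂ i j)
      P_ne := fun i j k hij hki hkj h ↦ by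
        have hbot := hconc i i.2 j j.2 k k.2 (Subtype.coe_ne_coe.mpr hij)
          (Subtype.coe_ne_coe.mpr hki.symm) (Subtype.coe_ne_coe.mpr hkj.symm)
        have hmem : P i j ∈ (i ⊓ j ⊓ k : Submodule ℝ (Fin 3 → ℝ)) :=
          ⟨⟨hP₁ i j, hP₂ i j⟩, (hfz _ _).mp h⟩
        rw [hbot, Submodule.mem_bot] at hmem
        exact hP₀ i j hmem
      B_sep := fun s t hst ↦ by
        by_contra! hle
        refine hst (Subtype.ext (Submodule.eq_of_le_of_finrank_eq (fun v hv ↦ ?_)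
          (by rw [hdim _ (.inr s.2), hdim _ (.inr t.2)])))
        exact (hgz t v).mp (hle v ((hgz s v).mpr hv)) }
  have hle := D.card_le_four (by simp; omega)
  simp only [Fintype.card_coe] at hle
  omega
end

section
/- Let Δ = (T, 𝒮, ℬ) be a triangle blocking arrangement and let R be any 𝒮̄-region (not necessarily minimal). Then the number of vertices of R that are internally blocked in R is even. -/
open Set

noncomputable section

/-- Points of the real plane. -/
abbrev Pt := ℝ × ℝ

/-- The boundary of the triangle with vertices `x1`, `x2`, `x3`:
the union of its three edges. -/
def triBdry (x1 x2 x3 : Pt) : Set Pt :=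
  segment ℝ x1 x2 ∪ segment ℝ x2 x3 ∪ segment ℝ x3 x1

/-- The three edges of the triangle with vertices `x1`, `x2`, `x3`. -/
def triEdges (x1 x2 x3 : Pt) : Set (Set Pt) :=
  {segment ℝ x1 x2, segment ℝ x2 x3, segment ℝ x3 x1}

/-- A triangle blocking arrangement: a nondegenerate triangle `x1 x2 x3` together with two
finite collections `S` (proper initial segments) and `B` (blocking segments) of closed
segments with endpoints on the boundary of the triangle and no interior point on the
boundary, satisfying the intersection conditions (i) and (ii). `S ∪ triEdges x1 x2 x3`
is the collection of initial segments `𝒮̄`. -/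
structure TBA where
  x1 : Pt
  x2 : Pt
  x3 : Pt
  S : Set (Set Pt)
  B : Set (Set Pt)
  indep : AffineIndependent ℝ ![x1, x2, x3]
  finS : S.Finite
  finB : B.Finite
  seg_wf : ∀ s ∈ S ∪ B, ∃ a b : Pt, a ≠ b ∧ s = segment ℝ a b ∧
    a ∈ triBdry x1 x2 x3 ∧ b ∈ triBdry x1 x2 x3 ∧
    ∀ p ∈ openSegment ℝ a b, p ∉ triBdry x1 x2 x3
  /- (i) no three initial segments are concurrent … -/
  no_three_concurrent : ∀ s₁ ∈ S ∪ triEdges x1 x2 x3, ∀ s₂ ∈ S ∪ triEdges x1 x2 x3,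
    ∀ s₃ ∈ S ∪ triEdges x1 x2 x3, s₁ ≠ s₂ → s₁ ≠ s₃ → s₂ ≠ s₃ →
    ¬ ∃ p : Pt, p ∈ s₁ ∧ p ∈ s₂ ∧ p ∈ s₃
  /- … and through every intersection point of two initial segments, not both edges,
  there is a unique blocking segment … -/
  block_exists : ∀ s₁ ∈ S ∪ triEdges x1 x2 x3, ∀ s₂ ∈ S ∪ triEdges x1 x2 x3, s₁ ≠ s₂ →
    ¬ (s₁ ∈ triEdges x1 x2 x3 ∧ s₂ ∈ triEdges x1 x2 x3) →
    ∀ p : Pt, p ∈ s₁ → p ∈ s₂ → ∃! b, b ∈ B ∧ p ∈ b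
  /- … while through an intersection point of two edges there is at most one
  blocking segment. -/
  block_unique : ∀ s₁ ∈ S ∪ triEdges x1 x2 x3, ∀ s₂ ∈ S ∪ triEdges x1 x2 x3, s₁ ≠ s₂ →
    ∀ p : Pt, p ∈ s₁ → p ∈ s₂ → ∀ b₁ ∈ B, ∀ b₂ ∈ B, p ∈ b₁ → p ∈ b₂ → b₁ = b₂
  /- (ii) through every intersection point of an initial segment and a blocking segment
  there is a unique second initial segment. -/
  second_segment : ∀ s ∈ S ∪ triEdges x1 x2 x3, ∀ b ∈ B, ∀ p : Pt, p ∈ s → p ∈ b →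
    ∃! s', s' ∈ S ∪ triEdges x1 x2 x3 ∧ s' ≠ s ∧ p ∈ s'

namespace TBA

variable (Δ : TBA)

/-- The collection `𝒮̄` of initial segments. -/
def Sbar : Set (Set Pt) := Δ.S ∪ triEdges Δ.x1 Δ.x2 Δ.x3

/-- The (closed) triangle `T`. -/
def tri : Set Pt := convexHull ℝ {Δ.x1, Δ.x2, Δ.x3}

/-- The boundary `∂T`. -/
def bdry : Set Pt := triBdry Δ.x1 Δ.x2 Δ.x3

/-- A vertex of the arrangement: an intersection point of two initial segments. -/
def IsVertex (p : Pt) : Prop :=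
  ∃ s₁ ∈ Δ.Sbar, ∃ s₂ ∈ Δ.Sbar, s₁ ≠ s₂ ∧ p ∈ s₁ ∧ p ∈ s₂

/-- The segment `xy` is minimal if no vertex of the arrangement lies in its interior. -/
def MinimalSeg (x y : Pt) : Prop :=
  ∀ p ∈ openSegment ℝ x y, ¬ Δ.IsVertex p

/-- An `𝒮̄`-region: the closure of a connected component of `T \ ⋃ L` for some
subset `L` of `𝒮̄`. -/
def IsRegion (R : Set Pt) : Prop :=
  ∃ L ⊆ Δ.Sbar, ∃ p ∈ Δ.tri \ ⋃₀ L,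
    R = closure (connectedComponentIn (Δ.tri \ ⋃₀ L) p)

/-- A minimal `𝒮̄`-region: the closure of a connected component of `T \ ⋃ 𝒮̄`. -/
def IsMinRegion (R : Set Pt) : Prop :=
  ∃ p ∈ Δ.tri \ ⋃₀ Δ.Sbar,
    R = closure (connectedComponentIn (Δ.tri \ ⋃₀ Δ.Sbar) p)

/-- The set `s` contains an edge of the region `R`: it contains a nondegenerate
segment lying on the boundary of `R`. -/
def ContainsEdgeOf (_Δ : TBA) (s R : Set Pt) : Prop :=
  ∃ q₁ q₂ : Pt, q₁ ≠ q₂ ∧ segment ℝ q₁ q₂ ⊆ s ∩ frontier R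

/-- A vertex of the region `R`: a point of `R` that is the intersection of two initial
segments, each containing an edge of `R`. -/
def IsRegionVertex (R : Set Pt) (p : Pt) : Prop :=
  p ∈ R ∧ ∃ s₁ ∈ Δ.Sbar, ∃ s₂ ∈ Δ.Sbar, s₁ ≠ s₂ ∧ p ∈ s₁ ∧ p ∈ s₂ ∧
    Δ.ContainsEdgeOf s₁ R ∧ Δ.ContainsEdgeOf s₂ R

/-- A vertex `p` is internally blocked in the region `R` if the blocking segment
through `p` exists and meets the interior of `R`.  (Externally blocked means not
internally blocked.) -/
def InternallyBlocked (R : Set Pt) (p : Pt) : Prop :=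
  ∃ b ∈ Δ.B, p ∈ b ∧ (b ∩ interior R).Nonempty

/-- Two consecutive vertices of a region `R`: distinct vertices joined by an edge
lying on the boundary of `R`. -/
def Consec (R : Set Pt) (u v : Pt) : Prop :=
  u ≠ v ∧ Δ.IsRegionVertex R u ∧ Δ.IsRegionVertex R v ∧ segment ℝ u v ⊆ frontier R

/-- Condition (A): the arrangement is strong when for every minimal `𝒮̄`-region `R` and
consecutive vertices `v₁, v₂, v₃, v₄, v₅` in this order along `∂R`, if the line
`l(v₁v₂)` and the blocking segment `β(v₃)` intersect inside `T`, and `β(v₃)` meets the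
interior of `R`, then `l(v₁v₂)`, `β(v₃)` and `l(v₄v₅)` are concurrent. -/
def Strong : Prop :=
  ∀ R : Set Pt, Δ.IsMinRegion R →
  ∀ v₁ v₂ v₃ v₄ v₅ : Pt, List.Pairwise (· ≠ ·) [v₁, v₂, v₃, v₄, v₅] →
    Δ.Consec R v₁ v₂ → Δ.Consec R v₂ v₃ → Δ.Consec R v₃ v₄ → Δ.Consec R v₄ v₅ →
    ∀ b ∈ Δ.B, v₃ ∈ b → (b ∩ interior R).Nonempty →
    (∃ q ∈ Δ.tri, q ∈ affineSpan ℝ ({v₁, v₂} : Set Pt) ∧ q ∈ b) →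
    ∃ q : Pt, q ∈ b ∧ q ∈ affineSpan ℝ ({v₁, v₂} : Set Pt) ∧
      q ∈ affineSpan ℝ ({v₄, v₅} : Set Pt)

end TBA

section Plane

/-- Two nonconstant affine functions on the plane with two common zeros have the same zeros. -/
lemma AffineMap.eq_zero_of_common_zeros {g h : Pt →ᵃ[ℝ] ℝ} (hg : g.linear ≠ 0) {q y x : Pt}
    (hqy : q ≠ y) (gq : g q = 0) (gy : g y = 0) (hq : h q = 0) (hy : h y = 0) (gx : g x = 0) :
    h x = 0 := by
  have key : ∀ (f : Pt →ᵃ[ℝ] ℝ), f q = 0 → ∀ z, f z =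
      (z.1 - q.1) * f.linear (1, 0) + (z.2 - q.2) * f.linear (0, 1) := by
    intro f fq z
    have h1 : f z = f.linear (z - q) + f q := by
      have := f.map_vadd q (z - q)
      simpa using this
    have h2 : z - q = (z.1 - q.1) • ((1, 0) : Pt) + (z.2 - q.2) • ((0, 1) : Pt) := by
      ext <;> simp
    rw [h1, h2, map_add, map_smul, map_smul, fq]
    simp
  rw [key g gq] at gy gx
  rw [key h hq] at hy
  rw [key h hq]
  have hne : g.linear (1, 0) ≠ 0 ∨ g.linear (0, 1) ≠ 0 := by
    by_contra! hcon
    apply hg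
    ext <;> simp [hcon.1, hcon.2]
  generalize g.linear (1, 0) = u at *
  generalize g.linear (0, 1) = v at *
  generalize h.linear (1, 0) = u' at *
  generalize h.linear (0, 1) = v' at *
  have hd : y.1 - q.1 ≠ 0 ∨ y.2 - q.2 ≠ 0 := by
    by_contra! hcon
    exact hqy (Prod.ext (by linarith [hcon.1]) (by linarith [hcon.2]))
  generalize y.1 - q.1 = d at *
  generalize y.2 - q.2 = e at *
  generalize x.1 - q.1 = r at *
  generalize x.2 - q.2 = t at *
  have h1 : r * e = t * d := by
    rcases hne with hu | hv
    · apply mul_left_cancel₀ hu; linear_combination e * gx - t * gy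
    · apply mul_left_cancel₀ hv; linear_combination -d * gx + r * gy
  rcases hd with h0 | h0
  · apply mul_left_cancel₀ h0; linear_combination r * hy - v' * h1
  · apply mul_left_cancel₀ h0; linear_combination t * hy + u' * h1

/-- A line in the plane is the zero set of a nonconstant affine function. -/
lemma exists_affineMap_line {a b : Pt} (hab : a ≠ b) :
    ∃ g : Pt →ᵃ[ℝ] ℝ, g.linear ≠ 0 ∧ ∀ x, g x = 0 ↔ ∃ t : ℝ, AffineMap.lineMap a b t = x := by
  set L : Pt →ₗ[ℝ] ℝ :=
    (b.1 - a.1) • LinearMap.snd ℝ ℝ ℝ - (b.2 - a.2) • LinearMap.fst ℝ ℝ ℝ with hL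
  have hLx : ∀ x, L x = (b.1 - a.1) * x.2 - (b.2 - a.2) * x.1 := by intro x; simp [hL]
  have hd : b.1 - a.1 ≠ 0 ∨ b.2 - a.2 ≠ 0 := by
    by_contra! hcon
    exact hab (Prod.ext (by linarith [hcon.1]) (by linarith [hcon.2]))
  refine ⟨L.toAffineMap - AffineMap.const ℝ Pt (L a), ?_, fun x => ?_⟩
  · intro h0
    have h1 : L = 0 := by simpa using h0
    have h2 := hLx (1, 0)
    have h3 := hLx (0, 1)
    rw [h1] at h2 h3
    simp at h2 h3
    rcases hd with h | h <;> apply h <;> linarith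
  · have hx : (L.toAffineMap - AffineMap.const ℝ Pt (L a)) x = L x - L a := rfl
    rw [hx, hLx, hLx]
    have hpos : 0 < (b.1 - a.1) ^ 2 + (b.2 - a.2) ^ 2 := by
      rcases hd with h | h <;> positivity
    constructor
    · intro h
      refine ⟨((x.1 - a.1) * (b.1 - a.1) + (x.2 - a.2) * (b.2 - a.2)) /
        ((b.1 - a.1) ^ 2 + (b.2 - a.2) ^ 2), ?_⟩
      ext
      · simp [AffineMap.lineMap_apply]
        field_simp
        linear_combination (b.2 - a.2) * h
      · simp [AffineMap.lineMap_apply]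
        field_simp
        linear_combination -(b.1 - a.1) * h
    · rintro ⟨t, rfl⟩
      simp [AffineMap.lineMap_apply]
      ring

lemma AffineMap.exists_ne_eq_zero {g : Pt →ᵃ[ℝ] ℝ} (hg : g.linear ≠ 0) {q : Pt} (hq : g q = 0) :
    ∃ z, q ≠ z ∧ g z = 0 := by
  refine ⟨(g.linear (0, 1), -g.linear (1, 0)) + q, fun he => hg ?_, ?_⟩
  · have h1 := right_eq_add.1 he
    rw [Prod.mk_eq_zero, neg_eq_zero] at h1
    ext <;> simp [h1.1, h1.2]
  · have h1 := g.map_vadd q (g.linear (0, 1), -g.linear (1, 0))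
    have h2 : ((g.linear (0, 1), -g.linear (1, 0)) : Pt) =
        g.linear (0, 1) • ((1, 0) : Pt) + (-g.linear (1, 0)) • ((0, 1) : Pt) := by
      ext <;> simp
    rw [vadd_eq_add, vadd_eq_add, hq, add_zero] at h1
    rw [h1, h2, map_add, map_smul, map_smul]
    simp only [smul_eq_mul]
    ring

lemma AffineMap.apply_lineMap_real (g : Pt →ᵃ[ℝ] ℝ) (x y : Pt) (t : ℝ) :
    g (AffineMap.lineMap x y t) = (1 - t) * g x + t * g y := by
  rw [AffineMap.apply_lineMap, AffineMap.lineMap_apply_ring]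

/-- A line through an interior point of a closed convex set meets the frontier in exactly two
points, provided that it meets the set only within a segment. -/
lemma ncard_segment_inter_frontier {R : Set Pt} (hconv : Convex ℝ R) (hcl : IsClosed R) {a b : Pt}
    (hab : a ≠ b) (hsub : ∀ t : ℝ, AffineMap.lineMap a b t ∈ R → t ∈ Icc (0 : ℝ) 1)
    (hint : (segment ℝ a b ∩ interior R).Nonempty) :
    (segment ℝ a b ∩ frontier R).ncard = 2 := by
  set f : ℝ →ᵃ[ℝ] Pt := AffineMap.lineMap a b with hf
  have hcont : Continuous f := AffineMap.lineMap_continuous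
  have hinj : Function.Injective f := AffineMap.lineMap_injective ℝ hab
  set J : Set ℝ := f ⁻¹' R with hJ
  have hJc : IsCompact J := isCompact_Icc.of_isClosed_subset (hcl.preimage hcont) hsub
  rw [segment_eq_image_lineMap] at hint ⊢
  obtain ⟨_, ⟨t₀, -, rfl⟩, ht₀⟩ := hint
  change f t₀ ∈ interior R at ht₀
  have ht₀J : t₀ ∈ J := interior_subset (s := R) ht₀
  have hne : J.Nonempty := ⟨t₀, ht₀J⟩
  obtain ⟨α, hα⟩ := hJc.exists_isLeast hne
  obtain ⟨β, hβ⟩ := hJc.exists_isGreatest hne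
  have hUJ : f ⁻¹' interior R ⊆ interior J :=
    interior_maximal (preimage_mono interior_subset) (isOpen_interior.preimage hcont)
  have hαi : f α ∉ interior R := by
    intro h
    have h1 : Ici α ∈ nhds α :=
      Filter.mem_of_superset (mem_interior_iff_mem_nhds.1 (hUJ h)) fun t ht => hα.2 ht
    have := mem_interior_iff_mem_nhds.2 h1
    simp at this
  have hβi : f β ∉ interior R := by
    intro h
    have h1 : Iic β ∈ nhds β :=
      Filter.mem_of_superset (mem_interior_iff_mem_nhds.1 (hUJ h)) fun t ht => hβ.2 ht
    have := mem_interior_iff_mem_nhds.2 h1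
    simp at this
  have hαt : α < t₀ := lt_of_le_of_ne (hα.2 ht₀J) (by rintro rfl; exact hαi ht₀)
  have htβ : t₀ < β := lt_of_le_of_ne (hβ.2 ht₀J) (by rintro rfl; exact hβi ht₀)
  have hmid : ∀ r ∈ J, ∀ t ∈ openSegment ℝ t₀ r, f t ∈ interior R := by
    intro r hr t ht
    apply hconv.openSegment_interior_self_subset_interior ht₀ hr
    rw [← image_openSegment]
    exact mem_image_of_mem f ht
  have heq : f '' Icc 0 1 ∩ frontier R = {f α, f β} := by
    ext x
    simp only [mem_inter_iff, mem_image, mem_insert_iff, mem_singleton_iff, hcl.frontier_eq,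
      mem_sdiff]
    constructor
    · rintro ⟨⟨t, -, rfl⟩, htR, hti⟩
      have h1 : α ≤ t := hα.2 htR
      have h2 : t ≤ β := hβ.2 htR
      rcases h1.eq_or_lt with rfl | h1
      · exact Or.inl rfl
      rcases h2.eq_or_lt with rfl | h2
      · exact Or.inr rfl
      exfalso
      rcases lt_trichotomy t t₀ with h | rfl | h
      · apply hti (hmid α hα.1 t _)
        rw [openSegment_symm, openSegment_eq_Ioo hαt]
        exact ⟨h1, h⟩
      · exact hti ht₀
      · apply hti (hmid β hβ.1 t _)
        rw [openSegment_eq_Ioo htβ]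
        exact ⟨h, h2⟩
    · rintro (rfl | rfl)
      · exact ⟨⟨α, hsub α hα.1, rfl⟩, hα.1, hαi⟩
      · exact ⟨⟨β, hsub β hβ.1, rfl⟩, hβ.1, hβi⟩
  rw [heq]
  exact ncard_pair fun h => (hαt.trans htβ).ne (hinj h)

end Plane

/-- A finite disjoint union of pairs has an even number of elements. -/
lemma even_ncard_biUnion_pairs {α ι : Type*} {I : Set ι} (hI : I.Finite) {A : ι → Set α}
    (hA : ∀ i ∈ I, (A i).ncard = 2) (hd : I.PairwiseDisjoint A) :
    (⋃ i ∈ I, A i).Finite ∧ Even (⋃ i ∈ I, A i).ncard := by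
  have hfin : ∀ i ∈ I, (A i).Finite := fun i hi => finite_of_ncard_pos (by rw [hA i hi]; norm_num)
  refine ⟨hI.biUnion hfin, ?_⟩
  induction I, hI using Set.Finite.induction_on with
  | empty => simp
  | @insert i I hi hI ih =>
    rw [biUnion_insert, ncard_union_eq _ (hfin i (mem_insert _ _))
      (hI.biUnion fun j hj => hfin j (mem_insert_of_mem _ hj)), hA i (mem_insert _ _)]
    · exact even_two.add (ih (fun j hj => hA j (mem_insert_of_mem _ hj))
        (hd.subset (subset_insert _ _)) fun j hj => hfin j (mem_insert_of_mem _ hj))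
    · rw [disjoint_iUnion₂_right]
      intro j hj
      exact hd (mem_insert _ _) (mem_insert_of_mem _ hj) (by rintro rfl; exact hi hj)

namespace TBA

variable (Δ : TBA)

/-- The affine function `g` cuts out the segment `s` from the triangle. -/
def Cuts (g : Pt →ᵃ[ℝ] ℝ) (s : Set Pt) : Prop :=
  g.linear ≠ 0 ∧ ∀ x, x ∈ s ↔ x ∈ Δ.tri ∧ g x = 0

/-- Barycentric coordinates, indexed by the edges on which they vanish. -/
lemma exists_edge_coords : ∃ g : Set Pt → (Pt →ᵃ[ℝ] ℝ),
    (∀ e ∈ triEdges Δ.x1 Δ.x2 Δ.x3, Δ.Cuts (g e) e) ∧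
    (∀ x, x ∈ Δ.tri ↔ ∀ e ∈ triEdges Δ.x1 Δ.x2 Δ.x3, 0 ≤ g e x) ∧
    ∃ m, ∀ e ∈ triEdges Δ.x1 Δ.x2 Δ.x3, 0 < g e m := by
  set b : AffineBasis (Fin 3) ℝ Pt := ⟨![Δ.x1, Δ.x2, Δ.x3], Δ.indep,
    Δ.indep.affineSpan_eq_top_iff_card_eq_finrank_add_one.2 (by simp)⟩ with hb
  have htri : ∀ x, x ∈ Δ.tri ↔ ∀ i, 0 ≤ b.coord i x := by
    intro x
    have h1 : Δ.tri = convexHull ℝ (range b) := by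
      have : range b = {Δ.x1, Δ.x2, Δ.x3} := by
        ext y
        simp only [mem_range, Fin.exists_fin_succ, IsEmpty.exists_iff, or_false, mem_insert_iff,
          mem_singleton_iff, eq_comm (b := y)]
        exact Iff.rfl
      rw [this]; rfl
    rw [h1, b.convexHull_eq_nonneg_coord]; rfl
  set E : Fin 3 → Set Pt := fun i => segment ℝ (b (i + 1)) (b (i + 2)) with hE
  have hrange : triEdges Δ.x1 Δ.x2 Δ.x3 = range E := by
    ext s
    have e0 : E 0 = segment ℝ Δ.x2 Δ.x3 := rfl
    have e1 : E 1 = segment ℝ Δ.x3 Δ.x1 := rfl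
    have e2 : E 2 = segment ℝ Δ.x1 Δ.x2 := rfl
    simp only [triEdges, mem_insert_iff, mem_singleton_iff, mem_range, Fin.exists_fin_succ,
      IsEmpty.exists_iff, or_false]
    change _ ↔ E 0 = s ∨ E 1 = s ∨ E 2 = s
    rw [e0, e1, e2]
    simp only [eq_comm (a := s)]
    tauto
  have hne : ∀ i : Fin 3, i ≠ i + 1 ∧ i ≠ i + 2 := by decide
  have huniv : ∀ i : Fin 3, Finset.univ = {i, i + 1, i + 2} := by decide
  have hn : ∀ i : Fin 3, i + 1 ≠ i + 2 := by decide
  have hcut : ∀ i x, x ∈ E i ↔ x ∈ Δ.tri ∧ b.coord i x = 0 := by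
    intro i x
    constructor
    · intro hx
      have hv : ∀ j, b j ∈ Δ.tri := by
        intro j
        rw [htri]
        intro k
        by_cases h : k = j
        · subst h; simp
        · rw [b.coord_apply_ne h]
      refine ⟨(convex_convexHull ℝ _).segment_subset (hv _) (hv _) hx, ?_⟩
      simp only [hE, segment_eq_image_lineMap] at hx
      obtain ⟨t, -, rfl⟩ := hx
      rw [AffineMap.apply_lineMap_real, b.coord_apply_ne (hne i).1, b.coord_apply_ne (hne i).2]
      simp
    · rintro ⟨hx, h0⟩
      rw [htri] at hx
      have h1 := b.sum_coord_apply_eq_one x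
      have h2 := b.linear_combination_coord_eq_self x
      rw [huniv i, Finset.sum_insert (by simp), Finset.sum_pair (hn i), h0] at h1 h2
      refine ⟨b.coord (i + 1) x, b.coord (i + 2) x, hx _, hx _, by simpa using h1, by simpa using h2⟩
  have hEinj : Function.Injective E := by
    intro i j hij
    by_contra hne'
    have h1 : b j ∈ E i := by
      rw [hcut]
      refine ⟨?_, b.coord_apply_ne hne'⟩
      rw [htri]
      intro k
      by_cases h : k = j
      · subst h; simp
      · rw [b.coord_apply_ne h]
    rw [hij, hcut] at h1
    simp at h1
  refine ⟨Function.extend E b.coord 0, ?_, ?_, ?_⟩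
  · rw [hrange]
    rintro _ ⟨i, rfl⟩
    rw [hEinj.extend_apply]
    refine ⟨fun h => ?_, hcut i⟩
    have h1 := (b.coord i).linearMap_vsub (b i) (b (i + 1))
    rw [h, b.coord_apply_ne (hne i).1] at h1
    simp at h1
  · intro x
    rw [hrange, forall_mem_range]
    simp only [hEinj.extend_apply, htri]
  · refine ⟨Finset.centroid ℝ Finset.univ b, ?_⟩
    rw [hrange, forall_mem_range]
    intro i
    rw [hEinj.extend_apply, b.coord_apply_centroid (Finset.mem_univ i)]
    simp

lemma convex_tri : Convex ℝ Δ.tri := convex_convexHull ℝ _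

lemma mem_bdry_iff {x : Pt} : x ∈ Δ.bdry ↔ ∃ e ∈ triEdges Δ.x1 Δ.x2 Δ.x3, x ∈ e := by
  simp [bdry, triBdry, triEdges, or_assoc]

/-- Every proper initial segment and every blocking segment is a full chord of the triangle. -/
lemma exists_chord {s : Set Pt} (hs : s ∈ Δ.S ∪ Δ.B) :
    ∃ a b, a ≠ b ∧ s = segment ℝ a b ∧ a ∈ Δ.bdry ∧ b ∈ Δ.bdry ∧
      (∀ p ∈ openSegment ℝ a b, p ∉ Δ.bdry) ∧
      ∀ t : ℝ, AffineMap.lineMap a b t ∈ Δ.tri → t ∈ Icc (0 : ℝ) 1 := by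
  obtain ⟨a, b, hab, rfl, ha, hb, hop⟩ := Δ.seg_wf s hs
  obtain ⟨g, hg, htri, -⟩ := Δ.exists_edge_coords
  refine ⟨a, b, hab, rfl, ha, hb, hop, ?_⟩
  have key : ∀ a b : Pt, a ∈ Δ.bdry → b ∈ Δ.bdry → (∀ p ∈ openSegment ℝ a b, p ∉ Δ.bdry) →
      ∀ t : ℝ, AffineMap.lineMap a b t ∈ Δ.tri → t ≤ 1 := by
    intro a b ha hb hop t ht
    by_contra! h1
    obtain ⟨e, he, hbe⟩ := Δ.mem_bdry_iff.1 hb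
    obtain ⟨e', he', hae'⟩ := Δ.mem_bdry_iff.1 ha
    have haT : a ∈ Δ.tri := (((hg e' he').2 a).1 hae').1
    have hbz := ((hg e he).2 b).1 hbe
    have hga := (htri a).1 haT e he
    have hgt := (htri _).1 ht e he
    rw [AffineMap.apply_lineMap_real, hbz.2] at hgt
    have hga0 : g e a = 0 := by nlinarith
    apply hop (midpoint ℝ a b) (midpoint_mem_openSegment a b)
    refine Δ.mem_bdry_iff.2 ⟨e, he, ((hg e he).2 _).2 ⟨?_, ?_⟩⟩
    · exact Δ.convex_tri.segment_subset haT hbz.1 (midpoint_mem_segment a b)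
    · rw [midpoint, AffineMap.apply_lineMap_real, hga0, hbz.2]; simp
  intro t ht
  refine ⟨?_, key a b ha hb hop t ht⟩
  have := key b a hb ha (by rwa [openSegment_symm]) (1 - t)
    (by rwa [AffineMap.lineMap_apply_one_sub])
  linarith

lemma bdry_subset_tri : Δ.bdry ⊆ Δ.tri := by
  intro x hx
  obtain ⟨g, hg, -⟩ := Δ.exists_edge_coords
  obtain ⟨e, he, hxe⟩ := Δ.mem_bdry_iff.1 hx
  exact (((hg e he).2 x).1 hxe).1

lemma exists_cuts_of_chord {s : Set Pt} (hs : s ∈ Δ.S ∪ Δ.B) : ∃ g, Δ.Cuts g s := by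
  obtain ⟨a, b, hab, rfl, ha, hb, -, hch⟩ := Δ.exists_chord hs
  obtain ⟨g, hg, hz⟩ := exists_affineMap_line hab
  refine ⟨g, hg, fun x => ?_⟩
  rw [hz]
  constructor
  · intro hx
    refine ⟨Δ.convex_tri.segment_subset (Δ.bdry_subset_tri ha) (Δ.bdry_subset_tri hb) hx, ?_⟩
    rw [segment_eq_image_lineMap] at hx
    obtain ⟨t, -, rfl⟩ := hx
    exact ⟨t, rfl⟩
  · rintro ⟨hx, t, rfl⟩
    rw [segment_eq_image_lineMap]
    exact mem_image_of_mem _ (hch t hx)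

lemma exists_cuts {s : Set Pt} (hs : s ∈ Δ.Sbar ∪ Δ.B) : ∃ g, Δ.Cuts g s := by
  rcases hs with (hs | hs) | hs
  · exact Δ.exists_cuts_of_chord (Or.inl hs)
  · obtain ⟨g, hg, -⟩ := Δ.exists_edge_coords
    exact ⟨g s, hg s hs⟩
  · exact Δ.exists_cuts_of_chord (Or.inr hs)

variable {Δ}

lemma Cuts.convex {g : Pt →ᵃ[ℝ] ℝ} {s : Set Pt} (h : Δ.Cuts g s) : Convex ℝ s := by
  have : s = Δ.tri ∩ g ⁻¹' {0} := by ext x; exact h.2 x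
  rw [this]
  exact Δ.convex_tri.inter ((convex_singleton (0 : ℝ)).affine_preimage g)

variable (Δ)

/-- Two distinct segments of the arrangement share at most one point. -/
lemma eq_of_two_common_points {s s' : Set Pt} (hs : s ∈ Δ.Sbar ∪ Δ.B) (hs' : s' ∈ Δ.Sbar ∪ Δ.B)
    {q y : Pt} (hqy : q ≠ y) (hq : q ∈ s) (hy : y ∈ s) (hq' : q ∈ s') (hy' : y ∈ s') :
    s = s' := by
  obtain ⟨g, hg, hgs⟩ := Δ.exists_cuts hs
  obtain ⟨h, hh, hhs⟩ := Δ.exists_cuts hs'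
  rw [hgs] at hq hy
  rw [hhs] at hq' hy'
  ext x
  rw [hgs, hhs]
  exact and_congr_right fun _ =>
    ⟨AffineMap.eq_zero_of_common_zeros hg hqy hq.2 hy.2 hq'.2 hy'.2,
      AffineMap.eq_zero_of_common_zeros hh hqy hq'.2 hy'.2 hq.2 hy.2⟩

lemma finite_Sbar : Δ.Sbar.Finite := Δ.finS.union (by simp [triEdges])

/-- A blocking segment is not an initial segment. -/
lemma not_mem_Sbar_of_mem_B {b : Set Pt} (hb : b ∈ Δ.B) : b ∉ Δ.Sbar := by
  intro hbS
  have hsub : b ⊆ ⋃ s ∈ Δ.Sbar \ {b}, s ∩ b := by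
    intro p hp
    obtain ⟨s, ⟨hs, hne, hps⟩, -⟩ := Δ.second_segment b hbS b hb p hp hp
    exact mem_biUnion (show s ∈ Δ.Sbar \ {b} from ⟨hs, hne⟩) ⟨hps, hp⟩
  have hfin : (⋃ s ∈ Δ.Sbar \ {b}, s ∩ b).Finite := by
    refine (Δ.finite_Sbar.subset sdiff_subset).biUnion fun s hs => Set.Subsingleton.finite ?_
    intro x hx y hy
    by_contra hxy
    exact hs.2 (Δ.eq_of_two_common_points (Or.inl hs.1) (Or.inr hb) hxy hx.1 hy.1 hx.2 hy.2)
  obtain ⟨a, c, hac, rfl, -⟩ := Δ.exists_chord (Or.inr hb)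
  have hinf : (segment ℝ a c).Infinite := by
    rw [segment_eq_image_lineMap]
    exact (Icc_infinite zero_lt_one).image (AffineMap.lineMap_injective ℝ hac).injOn
  exact hinf (hfin.subset hsub)

lemma eq_of_three_concurrent {s₁ s₂ s₃ : Set Pt} (h₁ : s₁ ∈ Δ.Sbar) (h₂ : s₂ ∈ Δ.Sbar)
    (h₃ : s₃ ∈ Δ.Sbar) (h12 : s₁ ≠ s₂) (h13 : s₁ ≠ s₃) {p : Pt} (p₁ : p ∈ s₁) (p₂ : p ∈ s₂)
    (p₃ : p ∈ s₃) : s₂ = s₃ := by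
  by_contra h23
  exact Δ.no_three_concurrent s₁ h₁ s₂ h₂ s₃ h₃ h12 h13 h23 ⟨p, p₁, p₂, p₃⟩

/-- `R` is the polygon given by the inequalities `0 ≤ g s x`, where `s` runs through a set `K` of
initial segments that contains the edges of the triangle. -/
structure IsPolygon (R : Set Pt) (K : Set (Set Pt)) (g : Set Pt → (Pt →ᵃ[ℝ] ℝ)) (p₀ : Pt) :
    Prop where
  subset_Sbar : K ⊆ Δ.Sbar
  edges_subset : triEdges Δ.x1 Δ.x2 Δ.x3 ⊆ K
  cuts : ∀ s ∈ K, Δ.Cuts (g s) s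
  mem_tri : ∀ x, x ∈ Δ.tri ↔ ∀ e ∈ triEdges Δ.x1 Δ.x2 Δ.x3, 0 ≤ g e x
  mem_iff : ∀ x, x ∈ R ↔ ∀ s ∈ K, 0 ≤ g s x
  pos : ∀ s ∈ K, 0 < g s p₀

lemma connectedComponentIn_eq {L : Set (Set Pt)} {g : Set Pt → (Pt →ᵃ[ℝ] ℝ)}
    (hg : ∀ s ∈ L, Δ.Cuts (g s) s) {p : Pt} (hp : p ∈ Δ.tri \ ⋃₀ L)
    (hpos : ∀ s ∈ L, 0 < g s p) :
    connectedComponentIn (Δ.tri \ ⋃₀ L) p = {x | x ∈ Δ.tri ∧ ∀ s ∈ L, 0 < g s x} := by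
  apply Subset.antisymm
  · intro x hx
    have hsub := connectedComponentIn_subset (Δ.tri \ ⋃₀ L) p
    refine ⟨(hsub hx).1, fun s hs => ?_⟩
    by_contra! hle
    obtain ⟨y, hy, hy0⟩ := isPreconnected_connectedComponentIn.intermediate_value hx
      (mem_connectedComponentIn hp) (g s).continuous_of_finiteDimensional.continuousOn
      ⟨hle, (hpos s hs).le⟩
    exact (hsub hy).2 ⟨s, hs, ((hg s hs).2 y).2 ⟨(hsub hy).1, hy0⟩⟩
  · apply IsPreconnected.subset_connectedComponentIn
    · apply Convex.isPreconnected
      have : {x | x ∈ Δ.tri ∧ ∀ s ∈ L, 0 < g s x} = Δ.tri ∩ ⋂ s ∈ L, g s ⁻¹' Ioi 0 := by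
        ext; simp
      rw [this]
      exact Δ.convex_tri.inter (convex_iInter₂ fun s _ => (convex_Ioi (0 : ℝ)).affine_preimage _)
    · exact ⟨hp.1, hpos⟩
    · rintro x ⟨hx, hxL⟩
      refine ⟨hx, ?_⟩
      rintro ⟨s, hs, hxs⟩
      exact (hxL s hs).ne' (((hg s hs).2 x).1 hxs).2

lemma IsRegion.exists_isPolygon {R : Set Pt} (hR : Δ.IsRegion R) :
    ∃ K g p₀, Δ.IsPolygon R K g p₀ := by
  obtain ⟨L, hL, p, hp, rfl⟩ := hR
  obtain ⟨c, hc, htri, m, hm⟩ := Δ.exists_edge_coords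
  have hex : ∀ s ∈ L ∪ triEdges Δ.x1 Δ.x2 Δ.x3, ∃ f, Δ.Cuts f s ∧ (s ∈ L → 0 < f p) ∧
      (s ∈ triEdges Δ.x1 Δ.x2 Δ.x3 → f = c s) := by
    intro s hs
    by_cases hE : s ∈ triEdges Δ.x1 Δ.x2 Δ.x3
    · refine ⟨c s, hc s hE, fun hsL => ?_, fun _ => rfl⟩
      refine lt_of_le_of_ne ((htri p).1 hp.1 s hE) fun h0 => hp.2 ⟨s, hsL, ?_⟩
      exact ((hc s hE).2 p).2 ⟨hp.1, h0.symm⟩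
    have hsL : s ∈ L := hs.resolve_right hE
    obtain ⟨f, hf, hfs⟩ := Δ.exists_cuts (Or.inl (hL hsL))
    have hne : f p ≠ 0 := fun h0 => hp.2 ⟨s, hsL, (hfs p).2 ⟨hp.1, h0⟩⟩
    rcases hne.lt_or_gt with h | h
    · refine ⟨-f, ⟨?_, fun x => ?_⟩, fun _ => ?_, fun h => absurd h hE⟩
      · simpa using hf
      · simpa using hfs x
      · simpa using h
    · exact ⟨f, ⟨hf, hfs⟩, fun _ => h, fun h => absurd h hE⟩
  choose! g hcut hpos hgc using hex
  have hgt : ∀ x, x ∈ Δ.tri ↔ ∀ e ∈ triEdges Δ.x1 Δ.x2 Δ.x3, 0 ≤ g e x := by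
    intro x
    rw [htri]
    exact forall₂_congr fun e he => by rw [hgc e (Or.inr he) he]
  set K := L ∪ triEdges Δ.x1 Δ.x2 Δ.x3 with hK
  have hKS : K ⊆ Δ.Sbar := union_subset hL subset_union_right
  have hp₀ : ∃ p₀, ∀ s ∈ K, 0 < g s p₀ := by
    have hev : ∀ᶠ t in nhdsWithin (0 : ℝ) (Ioi 0), ∀ s ∈ K, 0 < g s (AffineMap.lineMap p m t) := by
      rw [Filter.eventually_all_finite (Δ.finite_Sbar.subset hKS)]
      intro s hs
      by_cases hsL : s ∈ L
      · have hcont : Continuous fun t : ℝ => g s (AffineMap.lineMap p m t) :=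
          (g s).continuous_of_finiteDimensional.comp AffineMap.lineMap_continuous
        have h0 : 0 < g s (AffineMap.lineMap p m (0 : ℝ)) := by
          rw [AffineMap.lineMap_apply_zero]; exact hpos s hs hsL
        exact Filter.Eventually.filter_mono nhdsWithin_le_nhds
          (hcont.continuousAt.eventually (lt_mem_nhds h0))
      · have hE : s ∈ triEdges Δ.x1 Δ.x2 Δ.x3 := hs.resolve_left hsL
        filter_upwards [Ioo_mem_nhdsGT (zero_lt_one' ℝ)] with t ht
        rw [AffineMap.apply_lineMap_real]
        have h1 := (hgt p).1 hp.1 s hE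
        have h2 := hm s hE
        rw [← hgc s hs hE] at h2
        have h3 := mul_pos ht.1 h2
        have h4 := mul_nonneg (sub_nonneg.2 ht.2.le) h1
        linarith
    obtain ⟨t, ht⟩ := hev.exists
    exact ⟨_, ht⟩
  obtain ⟨p₀, hp₀⟩ := hp₀
  refine ⟨K, g, p₀, hKS, subset_union_right, hcut, hgt, fun x => ?_, hp₀⟩
  rw [Δ.connectedComponentIn_eq (fun s hs => hcut s (Or.inl hs)) hp
    fun s hs => hpos s (Or.inl hs) hs]
  constructor
  · intro hx s hs
    have hcl : IsClosed {x | 0 ≤ g s x} :=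
      isClosed_Ici.preimage (g s).continuous_of_finiteDimensional
    refine closure_minimal ?_ hcl hx
    rintro y ⟨hy, hyL⟩
    rcases hs with hs | hs
    · exact (hyL s hs).le
    · exact (hgt y).1 hy s hs
  · intro hx
    have hcont : Continuous fun t : ℝ => (AffineMap.lineMap x p₀ t : Pt) :=
      AffineMap.lineMap_continuous
    have hlim : Filter.Tendsto (fun t : ℝ => (AffineMap.lineMap x p₀ t : Pt))
        (nhdsWithin 0 (Ioi 0)) (nhds x) := by
      have := hcont.tendsto 0
      rw [AffineMap.lineMap_apply_zero] at this
      exact this.mono_left nhdsWithin_le_nhds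
    refine mem_closure_of_tendsto hlim ?_
    filter_upwards [Ioo_mem_nhdsGT (zero_lt_one' ℝ)] with t ht
    have hall : ∀ s ∈ K, 0 < g s (AffineMap.lineMap x p₀ t) := by
      intro s hs
      rw [AffineMap.apply_lineMap_real]
      have h3 := mul_pos ht.1 (hp₀ s hs)
      have h4 := mul_nonneg (sub_nonneg.2 ht.2.le) (hx s hs)
      linarith
    exact ⟨(hgt _).2 fun e he => (hall e (Or.inr he)).le, fun s hs => hall s (Or.inl hs)⟩

namespace IsPolygon

variable {Δ} {R : Set Pt} {K : Set (Set Pt)} {g : Set Pt → (Pt →ᵃ[ℝ] ℝ)} {p₀ : Pt}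

lemma finite (h : Δ.IsPolygon R K g p₀) : K.Finite := Δ.finite_Sbar.subset h.subset_Sbar

lemma subset_tri (h : Δ.IsPolygon R K g p₀) : R ⊆ Δ.tri := fun x hx =>
  (h.mem_tri x).2 fun e he => (h.mem_iff x).1 hx e (h.edges_subset he)

lemma eq_iInter (h : Δ.IsPolygon R K g p₀) : R = ⋂ s ∈ K, g s ⁻¹' Ici 0 := by
  ext x; simp [h.mem_iff]

lemma convex (h : Δ.IsPolygon R K g p₀) : Convex ℝ R := by
  rw [h.eq_iInter]
  exact convex_iInter₂ fun s _ => (convex_Ici (0 : ℝ)).affine_preimage _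

lemma isClosed (h : Δ.IsPolygon R K g p₀) : IsClosed R := by
  rw [h.eq_iInter]
  exact isClosed_biInter fun s _ => isClosed_Ici.preimage (g s).continuous_of_finiteDimensional

lemma mem_interior_iff (h : Δ.IsPolygon R K g p₀) {x : Pt} :
    x ∈ interior R ↔ ∀ s ∈ K, 0 < g s x := by
  constructor
  · intro hx s hs
    have hcont : Continuous fun t : ℝ => (AffineMap.lineMap x p₀ t : Pt) :=
      AffineMap.lineMap_continuous
    have hev : ∀ᶠ t in nhds (0 : ℝ), (AffineMap.lineMap x p₀ t : Pt) ∈ R := by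
      apply hcont.continuousAt.eventually
      simpa using mem_interior_iff_mem_nhds.1 hx
    obtain ⟨t, ht, ht0⟩ := ((hev.filter_mono nhdsWithin_le_nhds).and
      (self_mem_nhdsWithin (a := (0 : ℝ)) (s := Iio 0))).exists
    have h1 := (h.mem_iff _).1 ht s hs
    have h2 := h.pos s hs
    have ht0 : t < 0 := ht0
    rw [AffineMap.apply_lineMap_real] at h1
    by_contra! hle
    nlinarith
  · intro hx
    have hopen : IsOpen (⋂ s ∈ K, g s ⁻¹' Ioi 0) := h.finite.isOpen_biInter fun s _ =>
      isOpen_Ioi.preimage (g s).continuous_of_finiteDimensional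
    refine interior_maximal ?_ hopen (by simpa using hx)
    intro y hy
    simp only [mem_iInter, mem_preimage, mem_Ioi] at hy
    exact (h.mem_iff y).2 fun s hs => (hy s hs).le

lemma mem_iff_eq_zero (h : Δ.IsPolygon R K g p₀) {s : Set Pt} (hs : s ∈ K) {x : Pt}
    (hx : x ∈ R) : x ∈ s ↔ g s x = 0 := by
  rw [(h.cuts s hs).2, and_iff_right (h.subset_tri hx)]

lemma mem_frontier_iff (h : Δ.IsPolygon R K g p₀) {x : Pt} :
    x ∈ frontier R ↔ x ∈ R ∧ ∃ s ∈ K, x ∈ s := by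
  rw [h.isClosed.frontier_eq, mem_sdiff, h.mem_interior_iff]
  refine and_congr_right fun hx => ?_
  push Not
  refine exists_congr fun s => and_congr_right fun hs => ?_
  rw [h.mem_iff_eq_zero hs hx]
  exact ⟨fun hle => le_antisymm hle ((h.mem_iff x).1 hx s hs), fun he => he.le⟩

lemma inter_interior (h : Δ.IsPolygon R K g p₀) {s : Set Pt} (hs : s ∈ K) :
    ¬ (s ∩ interior R).Nonempty := by
  rintro ⟨x, hxs, hx⟩
  exact (h.mem_interior_iff.1 hx s hs).ne' (((h.cuts s hs).2 x).1 hxs).2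

/-- Near a point `q` of the polygon, only the constraints through `q` matter. -/
lemma eventually_lineMap (h : Δ.IsPolygon R K g p₀) {q y : Pt} (hq : q ∈ R)
    (hy : ∀ s ∈ K, q ∈ s → 0 ≤ g s y) :
    ∀ᶠ t in nhdsWithin (0 : ℝ) (Ioi 0), AffineMap.lineMap q y t ∈ R ∧
      ((∀ s ∈ K, q ∈ s → 0 < g s y) → AffineMap.lineMap q y t ∈ interior R) := by
  have hev : ∀ᶠ t in nhdsWithin (0 : ℝ) (Ioi 0), ∀ s ∈ K, q ∉ s →
      0 < g s (AffineMap.lineMap q y t) := by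
    rw [Filter.eventually_all_finite h.finite]
    intro s hs
    by_cases hqs : q ∈ s
    · exact Filter.Eventually.of_forall fun t h => absurd hqs h
    have hcont : Continuous fun t : ℝ => g s (AffineMap.lineMap q y t) :=
      (g s).continuous_of_finiteDimensional.comp AffineMap.lineMap_continuous
    have h0 : 0 < g s (AffineMap.lineMap q y (0 : ℝ)) := by
      rw [AffineMap.lineMap_apply_zero]
      refine lt_of_le_of_ne ((h.mem_iff q).1 hq s hs) fun h0 => hqs ?_
      exact (h.mem_iff_eq_zero hs hq).2 h0.symm
    filter_upwards [nhdsWithin_le_nhds (hcont.continuousAt.eventually (lt_mem_nhds h0))]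
      with t ht _ using ht
  filter_upwards [hev, self_mem_nhdsWithin] with t ht htpos
  have htpos : 0 < t := htpos
  have hact : ∀ s ∈ K, q ∈ s → g s (AffineMap.lineMap q y t) = t * g s y := by
    intro s hs hqs
    rw [AffineMap.apply_lineMap_real, (h.mem_iff_eq_zero hs hq).1 hqs]
    ring
  rw [h.mem_iff, h.mem_interior_iff]
  refine ⟨fun s hs => ?_, fun hstrict s hs => ?_⟩
  · by_cases hqs : q ∈ s
    · rw [hact s hs hqs]
      exact mul_nonneg htpos.le (hy s hs hqs)
    · exact (ht s hs hqs).le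
  · by_cases hqs : q ∈ s
    · rw [hact s hs hqs]
      exact mul_pos htpos (hstrict s hs hqs)
    · exact ht s hs hqs

/-- A chord through a point on a single side of the polygon, not along that side, enters the
interior. -/
lemma inter_interior_of_single_side (h : Δ.IsPolygon R K g p₀) {c s₀ : Set Pt}
    (hc : c ∈ Δ.S ∪ Δ.B) (hs₀ : s₀ ∈ K) {q : Pt} (hq : q ∈ R) (hqc : q ∈ c) (hqs : q ∈ s₀)
    (hne : c ≠ s₀) (hsingle : ∀ s ∈ K, q ∈ s → s = s₀) : (c ∩ interior R).Nonempty := by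
  have hcS : c ∈ Δ.Sbar ∪ Δ.B := hc.imp_left Or.inl
  obtain ⟨f, hf⟩ := Δ.exists_cuts_of_chord hc
  have hcT : c ⊆ Δ.tri := fun x hx => ((hf.2 x).1 hx).1
  have hz : ∀ y ∈ c, q ≠ y → g s₀ y ≠ 0 := fun y hy hqy h0 =>
    hne (Δ.eq_of_two_common_points hcS (Or.inl (h.subset_Sbar hs₀)) hqy hqc hy hqs
      (((h.cuts s₀ hs₀).2 y).2 ⟨hcT hy, h0⟩))
  obtain ⟨y, hyc, hypos⟩ : ∃ y ∈ c, 0 < g s₀ y := by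
    obtain ⟨a, b, hab, rfl, ha, hb, hop, -⟩ := Δ.exists_chord hc
    have hac := left_mem_segment ℝ a b
    have hbc := right_mem_segment ℝ a b
    by_cases hqb : q ∈ Δ.bdry
    · obtain ⟨e, he, hqe⟩ := Δ.mem_bdry_iff.1 hqb
      have hes := hsingle e (h.edges_subset he) hqe
      have hnn : ∀ y ∈ segment ℝ a b, 0 ≤ g s₀ y := fun y hy =>
        hes ▸ (h.mem_tri y).1 (hcT hy) e he
      by_cases hqa : q = a
      · exact ⟨b, hbc, lt_of_le_of_ne (hnn b hbc) (hz b hbc (hqa ▸ hab)).symm⟩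
      · exact ⟨a, hac, lt_of_le_of_ne (hnn a hac) (hz a hac hqa).symm⟩
    · have hqa : q ≠ a := fun h => hqb (h ▸ ha)
      have hqb' : q ≠ b := fun h => hqb (h ▸ hb)
      have hqo := mem_openSegment_of_ne_left_right hqa.symm hqb'.symm hqc
      rw [openSegment_eq_image_lineMap] at hqo
      obtain ⟨t, ht, rfl⟩ := hqo
      have h0 := (h.mem_iff_eq_zero hs₀ hq).1 hqs
      rw [AffineMap.apply_lineMap_real] at h0
      rcases (hz a hac hqa).lt_or_gt with h1 | h1
      · refine ⟨b, hbc, ?_⟩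
        by_contra! h2
        nlinarith [ht.1, ht.2]
      · exact ⟨a, hac, h1⟩
  have hev := h.eventually_lineMap (y := y) hq fun s hs hqs' => (hsingle s hs hqs' ▸ hypos).le
  obtain ⟨t, ⟨-, ht⟩, ht01⟩ := (hev.and (Ioo_mem_nhdsGT (zero_lt_one' ℝ))).exists
  refine ⟨AffineMap.lineMap q y t, ?_, ht fun s hs hqs' => hsingle s hs hqs' ▸ hypos⟩
  apply hf.convex.segment_subset hqc hyc
  rw [segment_eq_image_lineMap]
  exact mem_image_of_mem _ ⟨ht01.1.le, ht01.2.le⟩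

/-- Two sides of the polygon meeting at a point of it both contain an edge. -/
lemma containsEdgeOf (h : Δ.IsPolygon R K g p₀) {s s' : Set Pt} (hs : s ∈ K) (hs' : s' ∈ K)
    (hne : s ≠ s') {q : Pt} (hq : q ∈ R) (hqs : q ∈ s) (hqs' : q ∈ s') :
    Δ.ContainsEdgeOf s R := by
  have h0 := (h.mem_iff_eq_zero hs hq).1 hqs
  have h0' := (h.mem_iff_eq_zero hs' hq).1 hqs'
  obtain ⟨y, hqy, hy0, hypos⟩ : ∃ y, q ≠ y ∧ g s y = 0 ∧ 0 ≤ g s' y := by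
    obtain ⟨z, hzq, hz0⟩ := AffineMap.exists_ne_eq_zero (h.cuts s hs).1 h0
    rcases le_total 0 (g s' z) with hz | hz
    · exact ⟨z, hzq, hz0, hz⟩
    · refine ⟨AffineMap.lineMap q z (-1 : ℝ), ?_, ?_, ?_⟩
      · intro he
        have := AffineMap.lineMap_injective ℝ hzq
          ((AffineMap.lineMap_apply_zero q z).trans he)
        norm_num at this
      · rw [AffineMap.apply_lineMap_real, h0, hz0]; simp
      · rw [AffineMap.apply_lineMap_real, h0']; linarith
  have hev := h.eventually_lineMap (y := y) hq fun r hr hqr => by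
    by_cases hrs : s = r
    · exact hrs ▸ hy0.ge
    · rw [← Δ.eq_of_three_concurrent (h.subset_Sbar hs) (h.subset_Sbar hs') (h.subset_Sbar hr)
        hne hrs hqs hqs' hqr]
      exact hypos
  obtain ⟨t, ⟨ht, -⟩, ht0⟩ := (hev.and self_mem_nhdsWithin).exists
  have hts : AffineMap.lineMap q y t ∈ s := by
    rw [h.mem_iff_eq_zero hs ht, AffineMap.apply_lineMap_real, h0, hy0]
    simp
  refine ⟨q, AffineMap.lineMap q y t, ?_, fun x hx => ?_⟩
  · intro he
    exact (ne_of_gt (show 0 < t from ht0)) (AffineMap.lineMap_injective ℝ hqy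
      ((AffineMap.lineMap_apply_zero q y).trans he)).symm
  · have hxs := (h.cuts s hs).convex.segment_subset hqs hts hx
    exact ⟨hxs, h.mem_frontier_iff.2 ⟨h.convex.segment_subset hq ht hx, s, hs, hxs⟩⟩

lemma mem_of_containsEdgeOf (h : Δ.IsPolygon R K g p₀) {s : Set Pt} (hs : s ∈ Δ.Sbar)
    (he : Δ.ContainsEdgeOf s R) : s ∈ K := by
  obtain ⟨q₁, q₂, hne, hsub⟩ := he
  obtain ⟨h1, h1R⟩ := hsub (left_mem_segment ℝ q₁ q₂)
  obtain ⟨h2, h2R⟩ := hsub (right_mem_segment ℝ q₁ q₂)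
  have hm := (hsub (midpoint_mem_segment q₁ q₂)).2
  obtain ⟨hmR, r, hr, hmr⟩ := h.mem_frontier_iff.1 hm
  rw [h.mem_frontier_iff] at h1R h2R
  have hm0 := (h.mem_iff_eq_zero hr hmR).1 hmr
  have a1 := (h.mem_iff _).1 h1R.1 r hr
  have a2 := (h.mem_iff _).1 h2R.1 r hr
  rw [midpoint, AffineMap.apply_lineMap_real] at hm0
  norm_num at hm0
  have b1 : q₁ ∈ r := (h.mem_iff_eq_zero hr h1R.1).2 (by linarith)
  have b2 : q₂ ∈ r := (h.mem_iff_eq_zero hr h2R.1).2 (by linarith)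
  rwa [Δ.eq_of_two_common_points (Or.inl hs) (Or.inl (h.subset_Sbar hr)) hne h1 h2 b1 b2]

lemma even_ncard_crossings (h : Δ.IsPolygon R K g p₀) {I : Set (Set Pt)} (hI : I ⊆ Δ.S ∪ Δ.B)
    (hint : ∀ c ∈ I, (c ∩ interior R).Nonempty)
    (hd : ∀ c ∈ I, ∀ c' ∈ I, ∀ q ∈ frontier R, q ∈ c → q ∈ c' → c = c') :
    (⋃ c ∈ I, c ∩ frontier R).Finite ∧ Even (⋃ c ∈ I, c ∩ frontier R).ncard := by
  apply even_ncard_biUnion_pairs ((Δ.finS.union Δ.finB).subset hI)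
  · intro c hc
    have hn := hint c hc
    obtain ⟨a, b, hab, rfl, -, -, -, hch⟩ := Δ.exists_chord (hI hc)
    exact ncard_segment_inter_frontier h.convex h.isClosed hab
      (fun t ht => hch t (h.subset_tri ht)) hn
  · intro c hc c' hc' hne
    rw [Function.onFun, Set.disjoint_left]
    rintro q ⟨hqc, hq⟩ ⟨hqc', -⟩
    exact hne (hd c hc c' hc' q hq hqc hqc')

end IsPolygon

end TBA

/-- In any `𝒮̄`-region of a triangle blocking arrangement (not necessarily minimal),
the number of internally blocked vertices is even. -/
theorem TBA.internallyBlocked_even (Δ : TBA) (R : Set Pt) (hR : Δ.IsRegion R) :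
    Even {p : Pt | Δ.IsRegionVertex R p ∧ Δ.InternallyBlocked R p}.ncard := by
  obtain ⟨K, g, p₀, h⟩ := IsRegion.exists_isPolygon Δ hR
  set I : Set (Set Pt) := {s | s ∈ Δ.Sbar ∧ (s ∩ interior R).Nonempty} with hI
  set J : Set (Set Pt) := {b | b ∈ Δ.B ∧ (b ∩ interior R).Nonempty} with hJ
  have hIK : ∀ s ∈ I, s ∉ K := fun s hs hsK => h.inter_interior hsK hs.2
  have hIS : I ⊆ Δ.S := fun s hs => hs.1.resolve_right fun hE => hIK s hs (h.edges_subset hE)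
  obtain ⟨hNfin, hN⟩ := h.even_ncard_crossings (I := I) (hIS.trans subset_union_left)
    (fun c hc => hc.2) (by
      intro s hs s' hs' q hq hqs hqs'
      obtain ⟨-, r, hr, hqr⟩ := h.mem_frontier_iff.1 hq
      exact Δ.eq_of_three_concurrent (h.subset_Sbar hr) hs.1 hs'.1
        (fun e => hIK s hs (e ▸ hr)) (fun e => hIK s' hs' (e ▸ hr)) hqr hqs hqs')
  obtain ⟨hMfin, hM⟩ := h.even_ncard_crossings (I := J) (fun b hb => Or.inr hb.1)
    (fun c hc => hc.2) (by
      intro b hb b' hb' q hq hqb hqb'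
      obtain ⟨-, r, hr, hqr⟩ := h.mem_frontier_iff.1 hq
      obtain ⟨s, ⟨hs, hne, hqs⟩, -⟩ := Δ.second_segment r (h.subset_Sbar hr) b hb.1 q hqr hqb
      exact Δ.block_unique r (h.subset_Sbar hr) s hs hne.symm q hqr hqs b hb.1 b' hb'.1 hqb hqb')
  set C := {p : Pt | Δ.IsRegionVertex R p ∧ Δ.InternallyBlocked R p} with hC
  set N := ⋃ s ∈ I, s ∩ frontier R with hNdef
  set M := ⋃ b ∈ J, b ∩ frontier R with hMdef
  have hunion : C ∪ N = M := by
    ext q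
    simp only [hMdef, mem_iUnion₂, exists_prop, mem_inter_iff, mem_union, hNdef]
    constructor
    · rintro (⟨⟨hqR, s, hs, -, -, -, hqs, -, hse, -⟩, b, hb, hqb, hbR⟩ | ⟨s, hs, hqs, hq⟩)
      · exact ⟨b, ⟨hb, hbR⟩, hqb,
          h.mem_frontier_iff.2 ⟨hqR, s, h.mem_of_containsEdgeOf hs hse, hqs⟩⟩
      · obtain ⟨hqR, r, hr, hqr⟩ := h.mem_frontier_iff.1 hq
        have hne : s ≠ r := fun e => hIK s hs (e ▸ hr)
        obtain ⟨b, ⟨hb, hqb⟩, -⟩ := Δ.block_exists s hs.1 r (h.subset_Sbar hr) hne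
          (fun hE => hIK s hs (h.edges_subset hE.1)) q hqs hqr
        refine ⟨b, ⟨hb, ?_⟩, hqb, hq⟩
        refine h.inter_interior_of_single_side (Or.inr hb) hr hqR hqb hqr
          (fun e => Δ.not_mem_Sbar_of_mem_B hb (e ▸ h.subset_Sbar hr)) fun r' hr' hqr' => ?_
        exact Δ.eq_of_three_concurrent hs.1 (h.subset_Sbar hr') (h.subset_Sbar hr)
          (fun e => hIK s hs (e ▸ hr')) hne hqs hqr' hqr
    · rintro ⟨b, hb, hqb, hq⟩
      obtain ⟨hqR, r, hr, hqr⟩ := h.mem_frontier_iff.1 hq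
      obtain ⟨s, ⟨hs, hne, hqs⟩, -⟩ := Δ.second_segment r (h.subset_Sbar hr) b hb.1 q hqr hqb
      by_cases hsI : (s ∩ interior R).Nonempty
      · exact Or.inr ⟨s, ⟨hs, hsI⟩, hqs, hq⟩
      have hsK : s ∈ K := by
        by_contra hsK
        have hsS : s ∈ Δ.S := hs.resolve_right fun hE => hsK (h.edges_subset hE)
        refine hsI (h.inter_interior_of_single_side (Or.inl hsS) hr hqR hqs hqr hne
          fun r' hr' hqr' => ?_)
        exact Δ.eq_of_three_concurrent hs (h.subset_Sbar hr') (h.subset_Sbar hr)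
          (fun e => hsK (e ▸ hr')) hne hqs hqr' hqr
      exact Or.inl ⟨⟨hqR, s, hs, r, h.subset_Sbar hr, hne, hqs, hqr,
        h.containsEdgeOf hsK hr hne hqR hqs hqr, h.containsEdgeOf hr hsK hne.symm hqR hqr hqs⟩,
        b, hb.1, hqb, hb.2⟩
  have hdisj : Disjoint C N := by
    rw [Set.disjoint_left]
    rintro q ⟨⟨-, s₁, h₁, s₂, h₂, hne, hq₁, hq₂, he₁, he₂⟩, -⟩ hqN
    simp only [hNdef, mem_iUnion₂, exists_prop, mem_inter_iff] at hqN
    obtain ⟨s, hs, hqs, -⟩ := hqN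
    exact hne (Δ.eq_of_three_concurrent hs.1 h₁ h₂
      (fun e => hIK s hs (e ▸ h.mem_of_containsEdgeOf h₁ he₁))
      (fun e => hIK s hs (e ▸ h.mem_of_containsEdgeOf h₂ he₂)) hqs hq₁ hq₂)
  have hCfin : C.Finite := hMfin.subset (hunion ▸ subset_union_left)
  rw [← hunion, ncard_union_eq hdisj hCfin hNfin, Nat.even_add] at hM
  exact hM.2 hN
end
end
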